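/- arXiv:2401.02003 — 2 statements merged into one kernel-verified Lean document; each statement's English description precedes it below -/
import Mathlib

section
/- There exists a constant C > 0 such that for every δ with 0 < δ ≤ e^{−e}, the off-diagonal part of the Gagliardo integral of f(t) = (log(log(1/t)))^{−1/4} satisfies ∬_{{(x,y) : 0 < x, 2x < y ≤ δ}} |f(x) − f(y)|²/(y − x)² dx dy ≤ C / log(1/δ). -/
open MeasureTheory Set
open scoped ENNReal

noncomputable section

/-- The function `f(t) = (log(log(1/t)))^(-1/4)`. -/
def fGag (t : ℝ) : ℝ := Real.log (Real.log (1 / t)) ^ (-(1 / 4 : ℝ))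

lemma rpow_neg_quarter_sub_le {a b : ℝ} (ha : 1 ≤ a) (hab : a ≤ b) :
    |b ^ (-(1 / 4 : ℝ)) - a ^ (-(1 / 4 : ℝ))| ≤ b - a := by
  have ha0 : 0 < a := by linarith
  have hb0 : 0 < b := by linarith
  have hmono : b ^ (-(1 / 4 : ℝ)) ≤ a ^ (-(1 / 4 : ℝ)) :=
    Real.rpow_le_rpow_of_nonpos ha0 hab (by norm_num)
  have ha1 : a ^ (-(1 / 4 : ℝ)) ≤ 1 := Real.rpow_le_one_of_one_le_of_nonpos ha (by norm_num)
  have hpos : 0 < a ^ (-(1 / 4 : ℝ)) := Real.rpow_pos_of_pos ha0 _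
  have hr1 : a / b ≤ 1 := (div_le_one hb0).2 hab
  have hr : a / b ≤ (a / b) ^ (1 / 4 : ℝ) := by
    simpa using Real.rpow_le_rpow_of_exponent_ge (div_pos ha0 hb0) hr1
      (show (1 / 4 : ℝ) ≤ 1 by norm_num)
  have hfac : b ^ (-(1 / 4 : ℝ)) = a ^ (-(1 / 4 : ℝ)) * (a / b) ^ (1 / 4 : ℝ) := by
    rw [Real.div_rpow ha0.le hb0.le, Real.rpow_neg ha0.le, Real.rpow_neg hb0.le]
    field_simp
  have hsub : 1 - a / b ≤ b - a := by
    rw [one_sub_div hb0.ne']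
    exact div_le_self (by linarith) (by linarith)
  rw [abs_sub_comm, abs_of_nonneg (by linarith), hfac]
  nlinarith

lemma abs_fGag_sub_le {x y : ℝ} (hx : 0 < x) (hxy : x ≤ y) (hy : y ≤ Real.exp (-Real.exp 1)) :
    |fGag x - fGag y| ≤ Real.log (y / x) / (-Real.log y) := by
  have hy0 : 0 < y := by linarith
  have hL : Real.exp 1 ≤ -Real.log y := by
    have := Real.log_le_log hy0 hy
    rw [Real.log_exp] at this
    linarith
  have hL0 : 0 < -Real.log y := (Real.exp_pos 1).trans_le hL
  have hu : -Real.log y ≤ -Real.log x := neg_le_neg (Real.log_le_log hx hxy)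
  have h1 : 1 ≤ Real.log (-Real.log y) := by
    simpa using Real.log_le_log (Real.exp_pos 1) hL
  simp only [fGag, one_div, Real.log_inv]
  rw [← one_div]
  refine (rpow_neg_quarter_sub_le h1 (Real.log_le_log hL0 hu)).trans ?_
  rw [← Real.log_div (hL0.trans_le hu).ne' hL0.ne', Real.log_div hy0.ne' hx.ne']
  refine (Real.log_le_sub_one_of_pos (div_pos (hL0.trans_le hu) hL0)).trans_eq ?_
  rw [div_sub_one hL0.ne']
  ring

lemma fGag_kernel_le {x y : ℝ} (hx : 0 < x) (hxy : 2 * x < y)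
    (hy : y ≤ Real.exp (-Real.exp 1)) :
    (fGag x - fGag y) ^ 2 / (y - x) ^ 2 ≤
      64 * y ^ (1 / 2 : ℝ) / (y ^ 2 * Real.log y ^ 2) * x ^ (-(1 / 2) : ℝ) := by
  have hy0 : 0 < y := by linarith
  have hy1 : y < 1 := hy.trans_lt (by simp [Real.exp_pos])
  have hlog : 0 < -Real.log y := neg_pos.2 (Real.log_neg hy0 hy1)
  have hz : 0 < y / x := div_pos hy0 hx
  have hlz0 : 0 ≤ Real.log (y / x) := Real.log_nonneg ((one_le_div hx).2 (by linarith))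
  have hlz : Real.log (y / x) ^ 2 ≤ 16 * (y / x) ^ (1 / 2 : ℝ) := by
    have h := Real.log_le_rpow_div hz.le (show (0 : ℝ) < 1 / 4 by norm_num)
    have h2 : ((y / x) ^ (1 / 4 : ℝ)) ^ 2 = (y / x) ^ (1 / 2 : ℝ) := by
      rw [← Real.rpow_natCast, ← Real.rpow_mul hz.le]
      norm_num
    calc Real.log (y / x) ^ 2 ≤ ((y / x) ^ (1 / 4 : ℝ) / (1 / 4)) ^ 2 := by gcongr
      _ = 16 * (y / x) ^ (1 / 2 : ℝ) := by rw [← h2]; ring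
  have hnum : (fGag x - fGag y) ^ 2 ≤ 16 * (y / x) ^ (1 / 2 : ℝ) / Real.log y ^ 2 := by
    calc (fGag x - fGag y) ^ 2 = |fGag x - fGag y| ^ 2 := (sq_abs _).symm
      _ ≤ (Real.log (y / x) / (-Real.log y)) ^ 2 := by
        gcongr
        exact abs_fGag_sub_le hx (by linarith) hy
      _ = Real.log (y / x) ^ 2 / Real.log y ^ 2 := by rw [div_pow, neg_sq]
      _ ≤ _ := by gcongr
  calc (fGag x - fGag y) ^ 2 / (y - x) ^ 2
      ≤ (16 * (y / x) ^ (1 / 2 : ℝ) / Real.log y ^ 2) / (y / 2) ^ 2 := by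
        gcongr
        linarith
    _ = _ := by
        rw [Real.div_rpow hy0.le hx.le, Real.rpow_neg hx.le]
        field_simp
        norm_num

lemma lintegral_rpow_neg_half {y : ℝ} (hy : 0 ≤ y) :
    ∫⁻ x in Ioc 0 y, ENNReal.ofReal (x ^ (-(1 / 2) : ℝ)) =
      ENNReal.ofReal (2 * y ^ (1 / 2 : ℝ)) := by
  have hint : IntervalIntegrable (fun x : ℝ => x ^ (-(1 / 2) : ℝ)) volume 0 y :=
    intervalIntegral.intervalIntegrable_rpow' (by norm_num)
  rw [← ofReal_integral_eq_lintegral_ofReal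
    ((intervalIntegrable_iff_integrableOn_Ioc_of_le hy).1 hint)
    ((ae_restrict_iff' measurableSet_Ioc).2 (.of_forall fun x hx => Real.rpow_nonneg hx.1.le _)),
    ← intervalIntegral.integral_of_le hy, integral_rpow (Or.inl (by norm_num))]
  congr 1
  norm_num
  ring

lemma lintegral_inv_mul_log_sq {δ : ℝ} (hδ : 0 < δ) (hδ1 : δ < 1) :
    ∫⁻ y in Ioc 0 δ, ENNReal.ofReal (y⁻¹ / Real.log y ^ 2) =
      ENNReal.ofReal (1 / Real.log (1 / δ)) := by
  have hlog : ∀ y ∈ Ioc 0 δ, Real.log y ≠ 0 := fun y hy =>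
    (Real.log_neg hy.1 (hy.2.trans_lt hδ1)).ne
  have hderiv : ∀ y ∈ Ioc 0 δ,
      HasDerivAt (fun t => -(Real.log t)⁻¹) (y⁻¹ / Real.log y ^ 2) y := fun y hy =>
    ((Real.hasDerivAt_log hy.1.ne').inv (hlog y hy)).neg.congr_deriv (by rw [neg_div, neg_neg])
  have hcont : ContinuousOn (fun t => -(Real.log t)⁻¹) (Icc 0 δ) := by
    intro y hy
    rcases hy.1.eq_or_lt with rfl | h0
    · have hlim : Filter.Tendsto (fun t => -(Real.log t)⁻¹) (nhdsWithin 0 {0}ᶜ) (nhds 0) := by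
        simpa using (tendsto_inv_atBot_zero.comp Real.tendsto_log_nhdsNE_zero).neg
      have : ContinuousAt (fun t => -(Real.log t)⁻¹) 0 := by
        rw [continuousAt_iff_punctured_nhds]
        simpa using hlim
      exact this.continuousWithinAt
    · exact (hderiv y ⟨h0, hy.2⟩).continuousAt.continuousWithinAt
  have hnonneg : ∀ y ∈ Ioc 0 δ, 0 ≤ y⁻¹ / Real.log y ^ 2 := fun y hy =>
    div_nonneg (inv_nonneg.2 hy.1.le) (sq_nonneg _)
  have hint : IntegrableOn (fun y => y⁻¹ / Real.log y ^ 2) (Ioc 0 δ) :=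
    intervalIntegral.integrableOn_deriv_of_nonneg hcont
      (fun y hy => hderiv y ⟨hy.1, hy.2.le⟩) (fun y hy => hnonneg y ⟨hy.1, hy.2.le⟩)
  rw [← ofReal_integral_eq_lintegral_ofReal hint
    ((ae_restrict_iff' measurableSet_Ioc).2 (.of_forall hnonneg)),
    ← intervalIntegral.integral_of_le hδ.le,
    intervalIntegral.integral_eq_sub_of_hasDerivAt_of_le hδ.le hcont
      (fun y hy => hderiv y ⟨hy.1, hy.2.le⟩)
      ((intervalIntegrable_iff_integrableOn_Ioc_of_le hδ.le).2 hint)]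
  simp [inv_neg]

/-- There is a constant `C > 0` such that for every `0 < δ ≤ e^{-e}`, the off-diagonal part of
the Gagliardo integral of `f(t) = (log(log(1/t)))^(-1/4)`, over the region
`{(x,y) : 0 < x, 2x < y ≤ δ}`, is at most `C / log(1/δ)`. -/
theorem stmt2 :
    ∃ C : ℝ, 0 < C ∧
      ∀ δ : ℝ, 0 < δ → δ ≤ Real.exp (-Real.exp 1) →
        (∫⁻ p in {p : ℝ × ℝ | 0 < p.1 ∧ 2 * p.1 < p.2 ∧ p.2 ≤ δ},
            ENNReal.ofReal ((fGag p.1 - fGag p.2) ^ 2 / (p.2 - p.1) ^ 2))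
          ≤ ENNReal.ofReal (C / Real.log (1 / δ)) := by
  refine ⟨128, by norm_num, fun δ hδ hδe => ?_⟩
  have hδ1 : δ < 1 := hδe.trans_lt (by simp [Real.exp_pos])
  set c : ℝ → ℝ := fun y => 64 * y ^ (1 / 2 : ℝ) / (y ^ 2 * Real.log y ^ 2) with hc
  have hc0 : ∀ y, 0 < y → 0 ≤ c y := fun y hy => by
    have := Real.rpow_nonneg hy.le (1 / 2 : ℝ)
    simp only [hc]
    positivity
  set S : Set (ℝ × ℝ) := {p | 0 < p.1 ∧ 2 * p.1 < p.2 ∧ p.2 ≤ δ} with hS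
  set T : Set (ℝ × ℝ) := {p | 0 < p.1 ∧ p.1 ≤ p.2 ∧ p.2 ≤ δ} with hT
  have hSmeas : MeasurableSet S := by
    simp only [hS]
    measurability
  have hTmeas : MeasurableSet T := by
    simp only [hT]
    measurability
  have hST : S ⊆ T := fun p ⟨h0, h1, h2⟩ => ⟨h0, by linarith, h2⟩
  set F : ℝ × ℝ → ℝ≥0∞ := fun p => ENNReal.ofReal (c p.2 * p.1 ^ (-(1 / 2) : ℝ)) with hF
  have hFmeas : Measurable F := by
    simp only [hF, hc]
    fun_prop
  have hslice : ∀ y, ∫⁻ x, T.indicator F (x, y) =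
      (Ioc 0 δ).indicator (fun y => ENNReal.ofReal 128 * ENNReal.ofReal (y⁻¹ / Real.log y ^ 2)) y := by
    intro y
    by_cases hy : y ∈ Ioc 0 δ
    · have hind : ∀ x, T.indicator F (x, y) = (Ioc 0 y).indicator
          (fun x => ENNReal.ofReal (c y) * ENNReal.ofReal (x ^ (-(1 / 2) : ℝ))) x := by
        intro x
        have hiff : (x, y) ∈ T ↔ x ∈ Ioc 0 y :=
          ⟨fun h => ⟨h.1, h.2.1⟩, fun h => ⟨h.1, h.2, hy.2⟩⟩
        by_cases hx : x ∈ Ioc 0 y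
        · rw [indicator_of_mem (hiff.2 hx), indicator_of_mem hx,
            ← ENNReal.ofReal_mul (hc0 y hy.1)]
        · rw [indicator_of_notMem (hiff.not.2 hx), indicator_of_notMem hx]
      simp_rw [hind]
      rw [lintegral_indicator measurableSet_Ioc, lintegral_const_mul _ (by fun_prop),
        lintegral_rpow_neg_half hy.1.le, ← ENNReal.ofReal_mul (hc0 y hy.1), indicator_of_mem hy,
        ← ENNReal.ofReal_mul (by norm_num)]
      congr 1
      have hsq : y ^ (1 / 2 : ℝ) * y ^ (1 / 2 : ℝ) = y := by
        rw [← Real.rpow_add hy.1]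
        norm_num
      have hlog : Real.log y ≠ 0 := (Real.log_neg hy.1 (hy.2.trans_lt hδ1)).ne
      have hy0 : y ≠ 0 := hy.1.ne'
      calc c y * (2 * y ^ (1 / 2 : ℝ))
          = 128 * (y ^ (1 / 2 : ℝ) * y ^ (1 / 2 : ℝ)) / (y ^ 2 * Real.log y ^ 2) := by
            simp only [hc]
            ring
        _ = 128 * (y⁻¹ / Real.log y ^ 2) := by
            rw [hsq]
            field_simp
    · rw [indicator_of_notMem hy]
      have hind : ∀ x, T.indicator F (x, y) = 0 := fun x =>
        indicator_of_notMem (fun h => hy ⟨h.1.trans_le h.2.1, h.2.2⟩) _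
      simp [hind]
  calc ∫⁻ p in S, ENNReal.ofReal ((fGag p.1 - fGag p.2) ^ 2 / (p.2 - p.1) ^ 2)
      ≤ ∫⁻ p in S, F p := setLIntegral_mono' hSmeas fun p hp =>
        ENNReal.ofReal_le_ofReal (fGag_kernel_le hp.1 hp.2.1 (hp.2.2.trans hδe))
    _ ≤ ∫⁻ p in T, F p := lintegral_mono_set hST
    _ = ∫⁻ y, ∫⁻ x, T.indicator F (x, y) := by
        rw [← lintegral_indicator hTmeas, Measure.volume_eq_prod,
          lintegral_prod_symm' _ (hFmeas.indicator hTmeas)]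
    _ = ENNReal.ofReal (128 / Real.log (1 / δ)) := by
        simp_rw [hslice]
        rw [lintegral_indicator measurableSet_Ioc, lintegral_const_mul _ (by fun_prop),
          lintegral_inv_mul_log_sq hδ hδ1, ← ENNReal.ofReal_mul (by norm_num), mul_one_div]
end
end

section
/- For every Λ ≥ 1 there exist constants C > 0 and ε₀ ∈ (0,1), depending only on Λ, with the following property: for every κ > 0 and every κ-bounded weak solution (A, b, f, F, φ) with ellipticity Λ on B₁, setting α = ε₀ e^{−4Λκ}, one has |φ(x) − φ(y)| ≤ C e^{κ} |x − y|^{α} for all x, y ∈ B_{1/2}. -/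
open MeasureTheory Set Metric
open scoped ENNReal

noncomputable section

/-- `ℝ²` with the Euclidean norm. -/
abbrev E2 : Type := EuclideanSpace ℝ (Fin 2)

/-- The `i`-th partial derivative of `φ` at `x`. -/
def pd (φ : E2 → ℝ) (i : Fin 2) (x : E2) : ℝ := fderiv ℝ φ x (EuclideanSpace.single i 1)

/-- `|∇φ(x)|²`, the squared Euclidean norm of the gradient of `φ` at `x`. -/
def gradSq (φ : E2 → ℝ) (x : E2) : ℝ := ∑ i, pd φ i x ^ 2

/-- A `κ`-bounded weak solution with ellipticity `Λ` on `B₁`: a continuous map `A` from `B₁` to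
the symmetric `2×2` real matrices with `Λ⁻¹|ξ|² ≤ ⟨A(x)ξ, ξ⟩ ≤ Λ|ξ|²`; a continuous `b` with
`Λ⁻¹ ≤ b ≤ Λ`; a continuous `f` with `0 ≤ f ≤ 1`; a continuous `F`; and a `C¹` function `φ`
with `0 ≤ φ ≤ κ`, such that `|F(x)| ≤ |∇φ(x)|² + 1` on `B₁` and for every smooth compactly
supported `ψ` supported in `B₁`,
`∫_{B₁} ⟨A∇φ, ∇ψ⟩ = ∫_{B₁} b (1 - (1/2) f e^{φ} + F) ψ`. -/
structure IsWeakSol (Λ κ : ℝ) (A : E2 → Matrix (Fin 2) (Fin 2) ℝ)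
    (b f F φ : E2 → ℝ) : Prop where
  contA : ContinuousOn A (ball 0 1)
  symmA : ∀ x ∈ ball (0 : E2) 1, (A x).IsSymm
  ellip_lower : ∀ x ∈ ball (0 : E2) 1, ∀ ξ : Fin 2 → ℝ,
    Λ⁻¹ * (∑ i, ξ i ^ 2) ≤ ∑ i, ∑ j, A x i j * ξ j * ξ i
  ellip_upper : ∀ x ∈ ball (0 : E2) 1, ∀ ξ : Fin 2 → ℝ,
    ∑ i, ∑ j, A x i j * ξ j * ξ i ≤ Λ * (∑ i, ξ i ^ 2)
  contb : ContinuousOn b (ball 0 1)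
  b_lower : ∀ x ∈ ball (0 : E2) 1, Λ⁻¹ ≤ b x
  b_upper : ∀ x ∈ ball (0 : E2) 1, b x ≤ Λ
  contf : ContinuousOn f (ball 0 1)
  f_nonneg : ∀ x ∈ ball (0 : E2) 1, 0 ≤ f x
  f_le_one : ∀ x ∈ ball (0 : E2) 1, f x ≤ 1
  contF : ContinuousOn F (ball 0 1)
  smooth_φ : ContDiffOn ℝ 1 φ (ball 0 1)
  φ_nonneg : ∀ x ∈ ball (0 : E2) 1, 0 ≤ φ x
  φ_le_κ : ∀ x ∈ ball (0 : E2) 1, φ x ≤ κ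
  F_bound : ∀ x ∈ ball (0 : E2) 1, |F x| ≤ gradSq φ x + 1
  weak_eq : ∀ ψ : E2 → ℝ, ContDiff ℝ ((⊤ : ℕ∞) : WithTop ℕ∞) ψ → HasCompactSupport ψ →
    tsupport ψ ⊆ ball 0 1 →
    ∫ x in ball (0 : E2) 1, ∑ i, ∑ j, A x i j * pd φ j x * pd ψ i x =
      ∫ x in ball (0 : E2) 1, b x * (1 - (1 / 2) * f x * Real.exp (φ x) + F x) * ψ x

open Filter Topology Convolution in
/-- A weak formulation tested on smooth functions extends to `C¹` test functions. -/
theorem weak_eq_of_contDiff_one {V : Fin 2 → E2 → ℝ} {g : E2 → ℝ}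
    (hV : ∀ i, ContinuousOn (V i) (ball 0 1)) (hg : ContinuousOn g (ball 0 1))
    (h : ∀ ψ : E2 → ℝ, ContDiff ℝ ((⊤ : ℕ∞) : WithTop ℕ∞) ψ → HasCompactSupport ψ →
      tsupport ψ ⊆ ball 0 1 →
      ∫ x in ball (0 : E2) 1, ∑ i, V i x * pd ψ i x = ∫ x in ball (0 : E2) 1, g x * ψ x)
    {ψ : E2 → ℝ} (hψ : ContDiff ℝ 1 ψ) (hc : HasCompactSupport ψ) (hs : tsupport ψ ⊆ ball 0 1) :
    ∫ x in ball (0 : E2) 1, ∑ i, V i x * pd ψ i x = ∫ x in ball (0 : E2) 1, g x * ψ x := by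
  obtain ⟨δ, hδ, hK⟩ := hc.isCompact.exists_cthickening_subset_open isOpen_ball hs
  set K := cthickening δ (tsupport ψ) with hKdef
  have hKc : IsCompact K := hc.isCompact.cthickening
  let ρ : ℕ → ContDiffBump (0 : E2) := fun n =>
    ⟨δ / (n + 2) / 2, δ / (n + 2), by positivity, by
      have : 0 < δ / (n + 2) := by positivity
      linarith⟩
  have hρ : ∀ n, (ρ n).rOut = δ / (n + 2) := fun n => rfl
  have hρ0 : Tendsto (fun n => (ρ n).rOut) atTop (𝓝 0) := by
    simp only [hρ]
    have := (tendsto_const_div_atTop_nhds_zero_nat δ).comp (tendsto_add_atTop_nat 2)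
    refine this.congr fun n => ?_
    simp
  have hρδ : ∀ n, (ρ n).rOut ≤ δ := fun n => by
    rw [hρ]
    apply div_le_self hδ.le
    have : (0 : ℝ) ≤ n := n.cast_nonneg
    linarith
  let c : (E2 → ℝ) → ℕ → E2 → ℝ := fun u n =>
    ((ρ n).normed volume ⋆[ContinuousLinearMap.lsmul ℝ ℝ, volume] u)
  have hlim : ∀ u : E2 → ℝ, Continuous u → ∀ x, Tendsto (fun n => c u n x) atTop (𝓝 (u x)) :=
    fun u hu x => ContDiffBump.convolution_tendsto_right_of_continuous hρ0 hu x
  have hbdd : ∀ u : E2 → ℝ, Continuous u → ∀ B, (∀ x, |u x| ≤ B) → ∀ n x, |c u n x| ≤ 3 * B := by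
    intro u hu B hB n x
    have h1 := (ρ n).dist_normed_convolution_le (μ := volume) (x₀ := x) (ε := 2 * B)
      hu.aestronglyMeasurable (fun y _ => by
        rw [Real.dist_eq]
        exact (abs_sub _ _).trans (by linarith [hB x, hB y]))
    rw [Real.dist_eq] at h1
    have h2 := abs_le.1 h1
    have h3 := abs_le.1 (hB x)
    exact abs_le.2 ⟨by linarith [h2.1], by linarith [h2.2]⟩
  have hsupp : ∀ u : E2 → ℝ, (∀ x ∉ tsupport ψ, u x = 0) → ∀ n, ∀ x ∉ K, c u n x = 0 := by
    intro u hu n x hx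
    have hx' : ∀ y ∈ ball x (ρ n).rOut, u y = 0 := by
      intro y hy
      apply hu
      intro hy'
      apply hx
      exact mem_cthickening_of_dist_le x y δ _ hy'
        ((dist_comm y x ▸ (mem_ball.1 hy).le).trans (hρδ n))
    have hx0 := hx' x (mem_ball_self (ρ n).rOut_pos)
    have := (ρ n).normed_convolution_eq_right (μ := volume) (g := u) (x₀ := x)
      (fun y hy => by rw [hx' y hy, hx0])
    exact this.trans hx0
  have hpdc : ∀ i, Continuous (pd ψ i) := fun i =>
    (hψ.continuous_fderiv one_ne_zero).clm_apply continuous_const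
  have hpds : ∀ i, ∀ x ∉ tsupport ψ, pd ψ i x = 0 := fun i x hx => by
    rw [pd, fderiv_of_notMem_tsupport ℝ hx]; rfl
  have hψs : ∀ x ∉ tsupport ψ, ψ x = 0 := fun x hx => image_eq_zero_of_notMem_tsupport hx
  have hpd : ∀ n i x, pd (c ψ n) i x = c (pd ψ i) n x := by
    intro n i x
    have h1 := hc.hasFDerivAt_convolution_right (ContinuousLinearMap.lsmul ℝ ℝ) (μ := volume)
      ((ρ n).continuous_normed (μ := volume)).locallyIntegrable hψ x
    have h2 : pd (c ψ n) i x = _ := congrArg (fun L : E2 →L[ℝ] ℝ => L (EuclideanSpace.single i 1))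
      h1.fderiv
    rw [h2]
    exact convolution_precompR_apply (ContinuousLinearMap.lsmul ℝ ℝ)
      ((ρ n).continuous_normed (μ := volume)).locallyIntegrable
      (hc.fderiv (𝕜 := ℝ)) (hψ.continuous_fderiv one_ne_zero) x _
  have hsm : ∀ n, ContDiff ℝ ((⊤ : ℕ∞) : WithTop ℕ∞) (c ψ n) := fun n =>
    (ρ n).hasCompactSupport_normed.contDiff_convolution_left _ (ρ n).contDiff_normed
      hψ.continuous.locallyIntegrable
  have hts : ∀ n, tsupport (c ψ n) ⊆ K := fun n => by
    apply closure_minimal _ isClosed_cthickening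
    intro x hx
    by_contra hxK
    exact hx (hsupp ψ hψs n x hxK)
  have hcs : ∀ n, HasCompactSupport (c ψ n) := fun n =>
    hKc.of_isClosed_subset (isClosed_tsupport _) (hts n)
  have heq : ∀ n, ∫ x in ball (0 : E2) 1, ∑ i, V i x * c (pd ψ i) n x =
      ∫ x in ball (0 : E2) 1, g x * c ψ n x := fun n => by
    simpa only [hpd] using h _ (hsm n) (hcs n) ((hts n).trans hK)
  have key : ∀ W : E2 → ℝ, ContinuousOn W (ball 0 1) → ∀ u : E2 → ℝ, Continuous u →
      (∀ x ∉ tsupport ψ, u x = 0) →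
      Tendsto (fun n => ∫ x in ball (0 : E2) 1, W x * c u n x) atTop
        (𝓝 (∫ x in ball (0 : E2) 1, W x * u x)) ∧
      ∀ n, IntegrableOn (fun x => W x * c u n x) (ball 0 1) ∧
        IntegrableOn (fun x => W x * u x) (ball 0 1) := by
    intro W hW u hu hus
    have hucs : HasCompactSupport u := HasCompactSupport.intro hc.isCompact hus
    obtain ⟨B, hB⟩ := hucs.exists_bound_of_continuous hu
    have hcu : ∀ n, Continuous (c u n) := fun n =>
      (ρ n).hasCompactSupport_normed.continuous_convolution_left _ (ρ n).continuous_normed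
        hu.locallyIntegrable
    have hint : ∀ w : E2 → ℝ, Continuous w → (∀ x ∉ K, w x = 0) →
        IntegrableOn (fun x => W x * w x) (ball 0 1) := by
      intro w hw hw0
      have : IntegrableOn (fun x => W x * w x) K :=
        ((hW.mono hK).mul hw.continuousOn).integrableOn_compact hKc
      exact this.of_forall_sdiff_eq_zero measurableSet_ball fun x hx => by
        rw [hw0 x hx.2, mul_zero]
    have hint1 := fun n => hint _ (hcu n) (hsupp u hus n)
    have hint2 := hint u hu (fun x hx => hus x fun hx' => hx (self_subset_cthickening _ hx'))
    refine ⟨?_, fun n => ⟨hint1 n, hint2⟩⟩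
    refine tendsto_integral_of_dominated_convergence
      (bound := K.indicator fun x => |W x| * (3 * B)) (fun n => (hint1 n).aestronglyMeasurable)
      ?_ (fun n => Eventually.of_forall fun x => ?_) (Eventually.of_forall fun x => ?_)
    · have : IntegrableOn (fun x => |W x| * (3 * B)) K :=
        ((hW.mono hK).abs.mul continuousOn_const).integrableOn_compact hKc
      exact (this.integrable_indicator hKc.measurableSet).integrableOn
    · by_cases hx : x ∈ K
      · rw [indicator_of_mem hx, Real.norm_eq_abs, abs_mul]
        exact mul_le_mul_of_nonneg_left (hbdd u hu B hB n x) (abs_nonneg _)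
      · rw [indicator_of_notMem hx, hsupp u hus n x hx]; simp
    · exact (hlim u hu x).const_mul _
  have hR := key g hg ψ hψ.continuous hψs
  have hL : ∀ i, _ := fun i => key (V i) (hV i) (pd ψ i) (hpdc i) (hpds i)
  refine tendsto_nhds_unique ?_ hR.1
  simp only [← heq]
  have h3 : ∀ n, ∫ x in ball (0 : E2) 1, ∑ i, V i x * c (pd ψ i) n x =
      ∑ i, ∫ x in ball (0 : E2) 1, V i x * c (pd ψ i) n x := fun n =>
    integral_finsetSum _ fun i _ => ((hL i).2 n).1
  have h4 : ∫ x in ball (0 : E2) 1, ∑ i, V i x * pd ψ i x =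
      ∑ i, ∫ x in ball (0 : E2) 1, V i x * pd ψ i x :=
    integral_finsetSum _ fun i _ => ((hL i).2 0).2
  simp only [h3, h4]
  exact tendsto_finsetSum _ fun i _ => (hL i).1

/-- The unit vector with polar angle `θ`. -/
def dir (θ : ℝ) : E2 := !₂[Real.cos θ, Real.sin θ]

theorem norm_dir (θ : ℝ) : ‖dir θ‖ = 1 := by
  simp [dir, EuclideanSpace.norm_eq]

theorem continuous_dir : Continuous dir := by
  unfold dir
  fun_prop

theorem exists_dir {x c : E2} {ρ : ℝ} (h : x ∈ sphere c ρ) :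
    ∃ θ ∈ Icc (-Real.pi) Real.pi, x = c + ρ • dir θ := by
  let z : ℂ := ⟨x 0 - c 0, x 1 - c 1⟩
  have hz : ‖z‖ = ρ := by
    rw [mem_sphere, dist_eq_norm, EuclideanSpace.norm_eq] at h
    rw [← h, Complex.norm_def, Complex.normSq_apply]
    simp [z, pow_two]
  refine ⟨z.arg, ⟨(Complex.neg_pi_lt_arg z).le, Complex.arg_le_pi z⟩, ?_⟩
  have h1 := Complex.norm_mul_cos_arg z
  have h2 := Complex.norm_mul_sin_arg z
  rw [hz] at h1 h2
  ext i
  fin_cases i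
  · simp [dir, h1, z]
  · simp [dir, h2, z]

theorem lintegral_polar {F : E2 → ℝ≥0∞} (hF : Measurable F) (c : E2) :
    ∫⁻ x, F x = ∫⁻ r in Ioi (0 : ℝ), ∫⁻ θ in Ioo (-Real.pi) Real.pi,
      ENNReal.ofReal r * F (c + r • dir θ) := by
  have e : MeasurePreserving
      (fun p : ℝ × ℝ =>
        (MeasurableEquiv.toLp 2 (Fin 2 → ℝ)) (MeasurableEquiv.finTwoArrow.symm p)) :=
    (PiLp.volume_preserving_toLp (Fin 2)).comp (volume_preserving_finTwoArrow ℝ).symm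
  have hpt : ∀ r θ : ℝ, (MeasurableEquiv.toLp 2 (Fin 2 → ℝ))
      (MeasurableEquiv.finTwoArrow.symm (polarCoord.symm (r, θ))) = r • dir θ := by
    intro r θ
    ext i
    fin_cases i
    · change r * Real.cos θ = r * Real.cos θ
      rfl
    · change r * Real.sin θ = r * Real.sin θ
      rfl
  have hm : Measurable fun p : ℝ × ℝ => ENNReal.ofReal p.1 * F (c + p.1 • dir p.2) := by
    have : Continuous fun p : ℝ × ℝ => c + p.1 • dir p.2 :=
      continuous_const.add (continuous_fst.smul (continuous_dir.comp continuous_snd))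
    exact (ENNReal.measurable_ofReal.comp measurable_fst).mul (hF.comp this.measurable)
  calc ∫⁻ x, F x = ∫⁻ x, F (c + x) := (lintegral_add_left_eq_self F c).symm
    _ = ∫⁻ p : ℝ × ℝ, F (c + (MeasurableEquiv.toLp 2 (Fin 2 → ℝ))
          (MeasurableEquiv.finTwoArrow.symm p)) :=
        (e.lintegral_comp (hF.comp (measurable_const_add c))).symm
    _ = ∫⁻ p in Ioi (0 : ℝ) ×ˢ Ioo (-Real.pi) Real.pi,
          ENNReal.ofReal p.1 * F (c + p.1 • dir p.2) := by
        rw [← lintegral_comp_polarCoord_symm]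
        refine setLIntegral_congr_fun (measurableSet_Ioi.prod measurableSet_Ioo) fun p _ => ?_
        simp only [smul_eq_mul]
        rw [← hpt p.1 p.2]
    _ = _ := by
        rw [Measure.volume_eq_prod, setLIntegral_prod _ hm.aemeasurable]

/-- Averaging over radii: some circle carries at most the average share of `∫ h`. -/
theorem exists_good_radius {h : E2 → ℝ} {c : E2} {a b : ℝ} (ha : 0 ≤ a) (hab : a < b)
    (hc : ContinuousOn h (closedBall c b)) (h0 : ∀ x ∈ closedBall c b, 0 ≤ h x) :
    ∃ ρ ∈ Ioo a b, (b - a) * (ρ * ∫ θ in (-Real.pi)..Real.pi, h (c + ρ • dir θ)) ≤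
      ∫ x in ball c b, h x := by
  classical
  let h' : E2 → ℝ := (ball c b).piecewise h 0
  have hm : Measurable h' :=
    (hc.mono ball_subset_closedBall).measurable_piecewise continuousOn_const measurableSet_ball
  have hF : Measurable fun x => ENNReal.ofReal (h' x) := hm.ennreal_ofReal
  have hint : IntegrableOn h (ball c b) :=
    (hc.integrableOn_compact (isCompact_closedBall c b)).mono_set ball_subset_closedBall
  have h0' : ∀ x ∈ ball c b, 0 ≤ h x := fun x hx => h0 x (ball_subset_closedBall hx)
  have hE0 : 0 ≤ ∫ x in ball c b, h x := setIntegral_nonneg measurableSet_ball h0'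
  have hE : ∫⁻ x, ENNReal.ofReal (h' x) = ENNReal.ofReal (∫ x in ball c b, h x) := by
    rw [ofReal_integral_eq_lintegral_ofReal hint
      ((ae_restrict_iff' measurableSet_ball).2 (Filter.Eventually.of_forall h0')),
      ← lintegral_indicator measurableSet_ball]
    congr 1
    ext x
    by_cases hx : x ∈ ball c b
    · simp [h', hx]
    · simp [h', hx]
  rw [lintegral_polar hF c] at hE
  set m : ℝ → ℝ≥0∞ := fun r => ∫⁻ θ in Ioo (-Real.pi) Real.pi,
      ENNReal.ofReal r * ENNReal.ofReal (h' (c + r • dir θ)) with hmdef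
  have hmm : Measurable m := by
    have : Continuous fun p : ℝ × ℝ => c + p.1 • dir p.2 :=
      continuous_const.add (continuous_fst.smul (continuous_dir.comp continuous_snd))
    exact Measurable.lintegral_prod_right' (f := fun p : ℝ × ℝ =>
      ENNReal.ofReal p.1 * ENNReal.ofReal (h' (c + p.1 • dir p.2)))
      ((ENNReal.measurable_ofReal.comp measurable_fst).mul (hF.comp this.measurable))
  obtain ⟨ρ, hρ, hle⟩ := exists_le_setLAverage (μ := volume) (s := Ioo a b) (f := m)
    (by simp [hab]) (by simp) hmm.aemeasurable
  refine ⟨ρ, hρ, ?_⟩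
  have hρ0 : 0 < ρ := ha.trans_lt hρ.1
  have hin : ∀ θ, c + ρ • dir θ ∈ ball c b := fun θ => by
    simp [norm_smul, norm_dir, abs_of_pos hρ0, hρ.2]
  have hcc : Continuous fun θ => h (c + ρ • dir θ) := by
    refine (hc.mono ball_subset_closedBall).comp_continuous ?_ hin
    exact continuous_const.add (continuous_dir.const_smul ρ)
  have hmρ : m ρ = ENNReal.ofReal (ρ * ∫ θ in (-Real.pi)..Real.pi, h (c + ρ • dir θ)) := by
    rw [intervalIntegral.integral_of_le (by linarith [Real.pi_pos]),
      integral_Ioc_eq_integral_Ioo, ENNReal.ofReal_mul hρ0.le,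
      ofReal_integral_eq_lintegral_ofReal
        ((hcc.integrableOn_Icc (a := -Real.pi) (b := Real.pi)).mono_set Ioo_subset_Icc_self)
        (Filter.Eventually.of_forall fun θ => h0' _ (hin θ)), hmdef]
    simp only
    rw [lintegral_const_mul' _ _ ENNReal.ofReal_ne_top]
    congr 2
    ext θ
    rw [show h' (c + ρ • dir θ) = h (c + ρ • dir θ) from piecewise_eq_of_mem _ _ _ (hin θ)]
  have hle2 : ENNReal.ofReal (b - a) * m ρ ≤ ENNReal.ofReal (∫ x in ball c b, h x) := by
    rw [setLAverage_eq, Real.volume_Ioo] at hle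
    calc ENNReal.ofReal (b - a) * m ρ
        ≤ ENNReal.ofReal (b - a) * ((∫⁻ x in Ioo a b, m x) / ENNReal.ofReal (b - a)) := by gcongr
      _ ≤ ∫⁻ x in Ioo a b, m x := ENNReal.mul_div_le
      _ ≤ ∫⁻ x in Ioi 0, m x := lintegral_mono_set fun x hx => ha.trans_lt hx.1
      _ = _ := hE
  rw [hmρ, ← ENNReal.ofReal_mul (by linarith), ENNReal.ofReal_le_ofReal_iff hE0] at hle2
  exact hle2

theorem sq_intervalIntegral_abs_le {g : ℝ → ℝ} (hg : Continuous g) {a b : ℝ} (hab : a < b) :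
    (∫ t in a..b, |g t|) ^ 2 ≤ (b - a) * ∫ t in a..b, g t ^ 2 := by
  set I := ∫ t in a..b, |g t|
  have hba : 0 < b - a := sub_pos.2 hab
  have h1 : 0 ≤ ∫ t in a..b, (|g t| - I / (b - a)) ^ 2 :=
    intervalIntegral.integral_nonneg hab.le fun t _ => sq_nonneg _
  have h2 : ∫ t in a..b, (|g t| - I / (b - a)) ^ 2 =
      (∫ t in a..b, g t ^ 2) - I ^ 2 / (b - a) := by
    have : ∀ t, (|g t| - I / (b - a)) ^ 2 =
        g t ^ 2 - 2 * (I / (b - a)) * |g t| + (I / (b - a)) ^ 2 := fun t => by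
      rw [← sq_abs (g t)]; ring
    simp only [this]
    rw [intervalIntegral.integral_add, intervalIntegral.integral_sub,
      intervalIntegral.integral_const_mul, intervalIntegral.integral_const, smul_eq_mul]
    · change _ - 2 * (I / (b - a)) * I + _ = _
      field_simp
      ring
    all_goals exact Continuous.intervalIntegrable (by fun_prop) _ _
  rw [h2, sub_nonneg, div_le_iff₀ hba] at h1
  linarith

theorem fderiv_apply_eq (f : E2 → ℝ) (x v : E2) :
    fderiv ℝ f x v = v 0 * pd f 0 x + v 1 * pd f 1 x := by
  have : v = v 0 • EuclideanSpace.single 0 1 + v 1 • EuclideanSpace.single 1 1 := by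
    ext i; fin_cases i <;> simp
  conv_lhs => rw [this]
  simp [pd]

theorem continuousOn_pd {f : E2 → ℝ} {U : Set E2} (hU : IsOpen U) (hf : ContDiffOn ℝ 1 f U)
    (i : Fin 2) : ContinuousOn (pd f i) U :=
  (hf.continuousOn_fderiv_of_isOpen hU le_rfl).clm_apply continuousOn_const

theorem continuousOn_gradSq {f : E2 → ℝ} {U : Set E2} (hU : IsOpen U) (hf : ContDiffOn ℝ 1 f U) :
    ContinuousOn (gradSq f) U :=
  continuousOn_finsetSum _ fun i _ => (continuousOn_pd hU hf i).pow 2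

theorem gradSq_nonneg (f : E2 → ℝ) (x : E2) : 0 ≤ gradSq f x :=
  Finset.sum_nonneg fun _ _ => sq_nonneg _

/-- The oscillation of a `C¹` function on a circle is controlled by its gradient there. -/
theorem sq_sub_le_circle_integral {f : E2 → ℝ} {U : Set E2} (hU : IsOpen U)
    (hf : ContDiffOn ℝ 1 f U) {c : E2} {ρ : ℝ} (hρ : 0 < ρ) (hs : sphere c ρ ⊆ U) {z z' : E2}
    (hz : z ∈ sphere c ρ) (hz' : z' ∈ sphere c ρ) :
    (f z - f z') ^ 2 ≤
      2 * Real.pi * ρ ^ 2 * ∫ θ in (-Real.pi)..Real.pi, gradSq f (c + ρ • dir θ) := by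
  have hin : ∀ θ, c + ρ • dir θ ∈ U := fun θ => hs (by simp [norm_smul, norm_dir, hρ.le])
  have hcir : Continuous fun θ => c + ρ • dir θ :=
    continuous_const.add (continuous_dir.const_smul ρ)
  let g : ℝ → ℝ := fun θ => ρ * (-Real.sin θ * pd f 0 (c + ρ • dir θ) +
    Real.cos θ * pd f 1 (c + ρ • dir θ))
  have hpc : ∀ i, Continuous fun θ => pd f i (c + ρ • dir θ) := fun i =>
    (continuousOn_pd hU hf i).comp_continuous hcir hin
  have hgc : Continuous g := by
    have := hpc 0
    have := hpc 1
    fun_prop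
  have hderiv : ∀ θ, HasDerivAt (fun θ => f (c + ρ • dir θ)) (g θ) θ := by
    intro θ
    have h1 : HasDerivAt dir (!₂[-Real.sin θ, Real.cos θ] : E2) θ := by
      have hd : dir = fun t => Real.cos t • EuclideanSpace.single (0 : Fin 2) (1 : ℝ) +
          Real.sin t • EuclideanSpace.single (1 : Fin 2) (1 : ℝ) := by
        ext t i
        fin_cases i <;> simp [dir]
      rw [hd]
      refine (((Real.hasDerivAt_cos θ).smul_const _).add
        ((Real.hasDerivAt_sin θ).smul_const _)).congr_deriv ?_
      ext i
      fin_cases i <;> simp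
    have h2 := (h1.const_smul ρ).const_add c
    have h3 : HasFDerivAt f (fderiv ℝ f (c + ρ • dir θ)) (c + ρ • dir θ) :=
      ((hf.differentiableOn one_ne_zero).differentiableAt
        (hU.mem_nhds (hin θ))).hasFDerivAt
    have h4 := h3.comp_hasDerivAt θ h2
    refine h4.congr_deriv ?_
    rw [fderiv_apply_eq]
    simp [g]
    ring
  have hle : ∀ θ, g θ ^ 2 ≤ ρ ^ 2 * gradSq f (c + ρ • dir θ) := by
    intro θ
    simp only [g, gradSq, Fin.sum_univ_two, mul_pow]
    refine mul_le_mul_of_nonneg_left ?_ (sq_nonneg ρ)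
    have := Real.sin_sq_add_cos_sq θ
    set A := pd f 0 (c + ρ • dir θ)
    set B := pd f 1 (c + ρ • dir θ)
    have e : A ^ 2 + B ^ 2 - (-Real.sin θ * A + Real.cos θ * B) ^ 2 =
        (Real.cos θ * A + Real.sin θ * B) ^ 2 := by
      linear_combination (-A ^ 2 - B ^ 2) * this
    nlinarith [sq_nonneg (Real.cos θ * A + Real.sin θ * B)]
  obtain ⟨θ, hθ, rfl⟩ := exists_dir hz
  obtain ⟨θ', hθ', rfl⟩ := exists_dir hz'
  have hpi := Real.pi_pos
  have h1 : f (c + ρ • dir θ) - f (c + ρ • dir θ') = ∫ t in θ'..θ, g t :=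
    (intervalIntegral.integral_eq_sub_of_hasDerivAt (fun t _ => hderiv t)
      (hgc.intervalIntegrable _ _)).symm
  have h2 : |f (c + ρ • dir θ) - f (c + ρ • dir θ')| ≤ ∫ t in (-Real.pi)..Real.pi, |g t| := by
    rw [h1, ← Real.norm_eq_abs]
    refine (intervalIntegral.norm_integral_le_integral_norm_uIoc).trans ?_
    rw [intervalIntegral.integral_of_le (by linarith)]
    refine setIntegral_mono_set ?_ (Filter.Eventually.of_forall fun t => abs_nonneg _) ?_
    · exact (hgc.abs.integrableOn_Icc (a := -Real.pi) (b := Real.pi)).mono_set Ioc_subset_Icc_self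
    · exact (Ioc_subset_Ioc (le_inf hθ'.1 hθ.1) (sup_le hθ'.2 hθ.2)).eventuallyLE
  have h3 : ∫ t in (-Real.pi)..Real.pi, g t ^ 2 ≤
      ρ ^ 2 * ∫ θ in (-Real.pi)..Real.pi, gradSq f (c + ρ • dir θ) := by
    rw [← intervalIntegral.integral_const_mul]
    refine intervalIntegral.integral_mono_on (by linarith)
      ((hgc.pow 2).intervalIntegrable _ _) ?_ fun t _ => hle t
    exact (continuous_const.mul
      ((continuousOn_gradSq hU hf).comp_continuous hcir hin)).intervalIntegrable _ _
  calc (f (c + ρ • dir θ) - f (c + ρ • dir θ')) ^ 2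
      ≤ (∫ t in (-Real.pi)..Real.pi, |g t|) ^ 2 := by
        rw [← sq_abs]; exact pow_le_pow_left₀ (abs_nonneg _) h2 2
    _ ≤ (Real.pi - -Real.pi) * ∫ t in (-Real.pi)..Real.pi, g t ^ 2 :=
        sq_intervalIntegral_abs_le hgc (by linarith)
    _ ≤ (Real.pi - -Real.pi) *
          (ρ ^ 2 * ∫ θ in (-Real.pi)..Real.pi, gradSq f (c + ρ • dir θ)) :=
        mul_le_mul_of_nonneg_left h3 (by linarith)
    _ = _ := by ring

theorem exists_circle_osc_le {f : E2 → ℝ} {U : Set E2} (hU : IsOpen U)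
    (hf : ContDiffOn ℝ 1 f U) {c : E2} {b : ℝ} (hb : 0 < b) (hs : closedBall c b ⊆ U) :
    ∃ ρ ∈ Ioo (b / 2) b, ∀ z ∈ sphere c ρ, ∀ z' ∈ sphere c ρ,
      (f z - f z') ^ 2 ≤ 4 * Real.pi * ∫ x in ball c b, gradSq f x := by
  obtain ⟨ρ, hρ, h⟩ := exists_good_radius (a := b / 2) (by positivity) (by linarith)
    ((continuousOn_gradSq hU hf).mono hs) (fun x _ => gradSq_nonneg f x)
  refine ⟨ρ, hρ, fun z hz z' hz' => ?_⟩
  have hρ0 : 0 < ρ := (half_pos hb).trans hρ.1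
  have h1 := sq_sub_le_circle_integral hU hf hρ0
    ((sphere_subset_closedBall.trans (closedBall_subset_closedBall hρ.2.le)).trans hs) hz hz'
  set G := ∫ θ in (-Real.pi)..Real.pi, gradSq f (c + ρ • dir θ)
  have hG : 0 ≤ ρ * G := mul_nonneg hρ0.le
    (intervalIntegral.integral_nonneg (by linarith [Real.pi_pos]) fun θ _ => gradSq_nonneg f _)
  have h2 : ρ ^ 2 * G ≤ b * (ρ * G) := by nlinarith [hρ.2]
  have h3 : ρ ^ 2 * G ≤ 2 * ∫ x in ball c b, gradSq f x := by linarith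
  nlinarith [Real.pi_pos]

theorem exists_circle_sq_le {u : E2 → ℝ} (hu : ContDiff ℝ 1 u) (c : E2) {b : ℝ} (hb : 0 < b) :
    ∃ ρ ∈ Ioo (b / 2) b, ∀ z ∈ sphere c ρ,
      u z ^ 2 ≤ 40 * ∫ x in ball c b, (gradSq u x + u x ^ 2 / b ^ 2) := by
  have huU : ContDiffOn ℝ 1 u univ := hu.contDiffOn
  have hgc : Continuous (gradSq u) :=
    continuousOn_univ.1 (continuousOn_gradSq isOpen_univ huU)
  have huc := hu.continuous
  have hc1 : Continuous fun x => gradSq u x + u x ^ 2 / b ^ 2 :=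
    hgc.add ((huc.pow 2).div_const _)
  obtain ⟨ρ, hρ, h⟩ := exists_good_radius (c := c) (a := b / 2) (b := b) (by positivity)
    (by linarith) hc1.continuousOn
    (fun x _ => add_nonneg (gradSq_nonneg u x) (by positivity))
  refine ⟨ρ, hρ, fun z hz => ?_⟩
  have hρ0 : 0 < ρ := (half_pos hb).trans hρ.1
  set E := ∫ x in ball c b, (gradSq u x + u x ^ 2 / b ^ 2)
  have hcir : Continuous fun θ => c + ρ • dir θ :=
    continuous_const.add (continuous_dir.const_smul ρ)
  have hin : ∀ θ, c + ρ • dir θ ∈ sphere c ρ := fun θ => by simp [norm_smul, norm_dir, hρ0.le]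
  have hgθ : Continuous fun θ => gradSq u (c + ρ • dir θ) := hgc.comp hcir
  have huθ : Continuous fun θ => u (c + ρ • dir θ) ^ 2 := (huc.comp hcir).pow 2
  rw [intervalIntegral.integral_add (hgθ.intervalIntegrable _ _)
    ((huθ.div_const _).intervalIntegrable _ _), intervalIntegral.integral_div] at h
  set G := ∫ θ in (-Real.pi)..Real.pi, gradSq u (c + ρ • dir θ)
  set I := ∫ θ in (-Real.pi)..Real.pi, u (c + ρ • dir θ) ^ 2
  have hpi := Real.pi_pos
  have hG : 0 ≤ G :=
    intervalIntegral.integral_nonneg (by linarith) fun θ _ => gradSq_nonneg u _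
  have hI : 0 ≤ I := intervalIntegral.integral_nonneg (by linarith) fun θ _ => sq_nonneg _
  obtain ⟨z₀, hz₀, hmin⟩ := (isCompact_sphere c ρ).exists_isMinOn ⟨_, hin 0⟩
    (huc.pow 2).continuousOn
  have hI2 : 2 * Real.pi * u z₀ ^ 2 ≤ I := by
    have := intervalIntegral.integral_mono_on (a := -Real.pi) (b := Real.pi) (μ := volume)
      (f := fun _ => u z₀ ^ 2) (g := fun θ => u (c + ρ • dir θ) ^ 2) (by linarith)
      (by simp) (huθ.intervalIntegrable _ _)
      (fun θ _ => hmin (hin θ))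
    rw [intervalIntegral.integral_const, smul_eq_mul] at this
    linarith
  have hosc := sq_sub_le_circle_integral isOpen_univ huU hρ0 (subset_univ _) hz hz₀
  have hE : (b - b / 2) * (ρ * G) + (b - b / 2) * (ρ * (I / b ^ 2)) ≤ E := by linarith
  have hGp : 0 ≤ (b - b / 2) * (ρ * G) :=
    mul_nonneg (by linarith) (mul_nonneg hρ0.le hG)
  have hIp : 0 ≤ (b - b / 2) * (ρ * (I / b ^ 2)) :=
    mul_nonneg (by linarith) (mul_nonneg hρ0.le (by positivity))
  have h1 : ρ ^ 2 * G ≤ 2 * E := by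
    have : ρ ^ 2 * G ≤ b * (ρ * G) := by nlinarith [hρ.2, mul_nonneg hρ0.le hG]
    linarith
  have h2 : I ≤ 4 * E := by
    have h3 : I / 4 = (b - b / 2) * ((b / 2) * (I / b ^ 2)) := by field_simp; ring
    have h4 : (b - b / 2) * ((b / 2) * (I / b ^ 2)) ≤ (b - b / 2) * (ρ * (I / b ^ 2)) := by
      have := hρ.1.le
      have : 0 ≤ b - b / 2 := by linarith
      gcongr
    linarith
  have hE0 : 0 ≤ E := by linarith
  have h5 : (u z - u z₀) ^ 2 ≤ 4 * Real.pi * E := by nlinarith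
  have h6 : u z₀ ^ 2 ≤ E := by nlinarith [Real.pi_gt_three, sq_nonneg (u z₀)]
  have h7 : (u z - u z₀) ^ 2 ≤ 13 * E := by nlinarith [Real.pi_lt_d2]
  nlinarith [sq_nonneg (u z - 2 * u z₀)]

theorem pd_comp {g : ℝ → ℝ} {g' : ℝ} {P : E2 → ℝ} {x : E2} (hg : HasDerivAt g g' (P x))
    (hP : DifferentiableAt ℝ P x) (i : Fin 2) :
    pd (fun y => g (P y)) i x = g' * pd P i x := by
  have := (hg.comp_hasFDerivAt x hP.hasFDerivAt).fderiv
  unfold pd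
  rw [show (fun y => g (P y)) = g ∘ P from rfl, this]
  simp

theorem pd_mul {P Q : E2 → ℝ} {x : E2} (hP : DifferentiableAt ℝ P x)
    (hQ : DifferentiableAt ℝ Q x) (i : Fin 2) :
    pd (fun y => P y * Q y) i x = P x * pd Q i x + Q x * pd P i x := by
  unfold pd
  rw [fderiv_fun_mul hP hQ]
  simp

theorem pd_congr {P Q : E2 → ℝ} {x : E2} (h : P =ᶠ[nhds x] Q) (i : Fin 2) :
    pd P i x = pd Q i x := by
  unfold pd
  rw [h.fderiv_eq]

theorem integral_mul_pd {l v : E2 → ℝ} (i : Fin 2) (hl : Differentiable ℝ l)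
    (hv : Differentiable ℝ v) (h1 : Integrable fun x => pd l i x * v x)
    (h2 : Integrable fun x => l x * pd v i x) (h3 : Integrable fun x => l x * v x) :
    ∫ x, l x * pd v i x = -∫ x, pd l i x * v x :=
  integral_mul_fderiv_eq_neg_fderiv_mul_of_integrable h1 h2 h3 (fun x _ => hl x) (fun x _ => hv x)

theorem pd_coord_sub (c : E2) (i : Fin 2) (x : E2) : pd (fun y : E2 => y i - c i) i x = 1 := by
  have : HasFDerivAt (fun y : E2 => y i - c i) (EuclideanSpace.proj (𝕜 := ℝ) i : E2 →L[ℝ] ℝ) x :=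
    (EuclideanSpace.proj (𝕜 := ℝ) i : E2 →L[ℝ] ℝ).hasFDerivAt.sub_const _
  unfold pd
  rw [this.fderiv]
  simp

theorem continuous_pd {u : E2 → ℝ} (hu : ContDiff ℝ 1 u) (i : Fin 2) : Continuous (pd u i) :=
  (hu.continuous_fderiv one_ne_zero).clm_apply continuous_const

theorem hasCompactSupport_pd {u : E2 → ℝ} (hu : HasCompactSupport u) (i : Fin 2) :
    HasCompactSupport (pd u i) :=
  hu.fderiv_apply (𝕜 := ℝ) _

theorem integrable_sq_of_hasCompactSupport {u : E2 → ℝ} (hu : Continuous u)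
    (hc : HasCompactSupport u) : Integrable fun x => u x ^ 2 := by
  have h : HasCompactSupport fun x => u x ^ 2 := hc.comp_left (g := fun t => t ^ 2) (by simp)
  exact (hu.pow 2).integrable_of_hasCompactSupport h

theorem integrable_gradSq {u : E2 → ℝ} (hu : ContDiff ℝ 1 u) (hc : HasCompactSupport u) :
    Integrable (gradSq u) :=
  integrable_finsetSum _ fun i _ =>
    integrable_sq_of_hasCompactSupport (continuous_pd hu i) (hasCompactSupport_pd hc i)

theorem sq_coord_sub_le {c x : E2} {r : ℝ} (hx : x ∈ closedBall c r) (i : Fin 2) :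
    (x i - c i) ^ 2 ≤ r ^ 2 := by
  have h2 := PiLp.norm_apply_le (x - c) i
  have h3 : ‖x - c‖ ≤ r := by simpa [dist_eq_norm] using hx
  rw [Real.norm_eq_abs] at h2
  have h4 := abs_le.1 (h2.trans h3)
  rw [PiLp.sub_apply] at h4
  exact sq_le_sq' h4.1 h4.2

theorem integral_coord_mul {u : E2 → ℝ} (hu : ContDiff ℝ 1 u) (hcs : HasCompactSupport u)
    (c : E2) (i : Fin 2) :
    Integrable (fun x => (x i - c i) * (2 * u x * pd u i x)) ∧
    ∫ x, (x i - c i) * (2 * u x * pd u i x) = -∫ x, u x ^ 2 := by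
  have huc := hu.continuous
  have hdif : Differentiable ℝ u := hu.differentiable one_ne_zero
  have hsq : ∀ x, pd (fun y => u y ^ 2) i x = 2 * u x * pd u i x := fun x =>
    pd_comp (g := fun t => t ^ 2) (by simpa using hasDerivAt_pow 2 (u x)) (hdif x) i
  have hlc : Continuous fun x : E2 => x i - c i := by fun_prop
  have hld : Differentiable ℝ fun x : E2 => x i - c i := by fun_prop
  have hu2s : HasCompactSupport fun x => u x ^ 2 := hcs.comp_left (g := fun t => t ^ 2) (by simp)
  have hui := integrable_sq_of_hasCompactSupport huc hcs
  have hli : Integrable fun x => (x i - c i) * (2 * u x * pd u i x) :=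
    (hlc.mul ((continuous_const.mul huc).mul (continuous_pd hu i))).integrable_of_hasCompactSupport
      ((hasCompactSupport_pd hcs i).mul_left.mul_left)
  have hlu : Integrable fun x => (x i - c i) * u x ^ 2 :=
    (hlc.mul (huc.pow 2)).integrable_of_hasCompactSupport hu2s.mul_left
  have := integral_mul_pd (l := fun x => x i - c i) (v := fun x => u x ^ 2) i hld (hdif.pow 2)
    (by simpa only [pd_coord_sub, one_mul] using hui) (by simpa only [hsq] using hli) hlu
  simp only [pd_coord_sub, hsq, one_mul] at this
  exact ⟨hli, this⟩

/-- Poincaré inequality for functions supported in a ball. -/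
theorem integral_sq_le_gradSq {u : E2 → ℝ} (hu : ContDiff ℝ 1 u) {c : E2} {r : ℝ}
    (h0 : ∀ x ∉ closedBall c r, u x = 0) :
    ∫ x, u x ^ 2 ≤ 4 * r ^ 2 * ∫ x, gradSq u x := by
  have hcs : HasCompactSupport u := HasCompactSupport.intro (isCompact_closedBall c r) h0
  have hui := integrable_sq_of_hasCompactSupport hu.continuous hcs
  have hgi := integrable_gradSq hu hcs
  obtain ⟨hli, hibp⟩ := integral_coord_mul hu hcs c 0
  have hle : ∫ x, -((x 0 - c 0) * (2 * u x * pd u 0 x)) ≤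
      ∫ x, (1 / 2 * u x ^ 2 + 2 * r ^ 2 * gradSq u x) := by
    refine integral_mono hli.neg ((hui.const_mul _).add (hgi.const_mul _)) fun x => ?_
    have hg := gradSq_nonneg u x
    by_cases hx : x ∈ closedBall c r
    · have h4 : pd u 0 x ^ 2 ≤ gradSq u x := by
        simp only [gradSq, Fin.sum_univ_two]
        nlinarith [sq_nonneg (pd u 1 x)]
      have h5 : (x 0 - c 0) ^ 2 * pd u 0 x ^ 2 ≤ r ^ 2 * gradSq u x :=
        mul_le_mul (sq_coord_sub_le hx 0) h4 (sq_nonneg _) (sq_nonneg _)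
      have h6 := sq_nonneg (u x + 2 * ((x 0 - c 0) * pd u 0 x))
      simp only
      linarith
    · simp only [h0 x hx]
      have := mul_nonneg (sq_nonneg r) hg
      linarith
  rw [integral_neg, hibp, integral_add (hui.const_mul _) (hgi.const_mul _), integral_const_mul,
    integral_const_mul] at hle
  linarith

/-- A `C¹` version of the positive part. -/
def softPos (t : ℝ) : ℝ := ∫ τ in (0 : ℝ)..t, min (max τ 0) 1

theorem hasDerivAt_softPos (t : ℝ) : HasDerivAt softPos (min (max t 0) 1) t :=
  intervalIntegral.integral_hasDerivAt_right
    (Continuous.intervalIntegrable (by fun_prop) _ _)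
    (Continuous.stronglyMeasurableAtFilter (by fun_prop) _ _)
    (Continuous.continuousAt (by fun_prop))

theorem contDiff_softPos : ContDiff ℝ 1 softPos := by
  rw [contDiff_one_iff_deriv]
  refine ⟨fun t => (hasDerivAt_softPos t).differentiableAt, ?_⟩
  rw [show deriv softPos = fun t => min (max t 0) 1 from
    funext fun t => (hasDerivAt_softPos t).deriv]
  fun_prop

theorem monotone_softPos : Monotone softPos :=
  monotone_of_deriv_nonneg (fun t => (hasDerivAt_softPos t).differentiableAt) fun t => by
    rw [(hasDerivAt_softPos t).deriv]
    exact le_min (le_max_right _ _) zero_le_one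

theorem softPos_zero : softPos 0 = 0 := by simp [softPos]

theorem softPos_of_nonpos {t : ℝ} (ht : t ≤ 0) : softPos t = 0 := by
  unfold softPos
  rw [intervalIntegral.integral_congr (g := fun _ => 0), intervalIntegral.integral_zero]
  intro τ hτ
  rw [uIcc_of_ge ht] at hτ
  simp [max_eq_right hτ.2]

theorem softPos_nonneg (t : ℝ) : 0 ≤ softPos t := by
  rcases le_total t 0 with h | h
  · rw [softPos_of_nonpos h]
  · rw [← softPos_zero]
    exact monotone_softPos h

theorem sub_one_le_softPos (t : ℝ) : t - 1 ≤ softPos t := by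
  rcases le_total t 1 with h | h
  · linarith [softPos_nonneg t]
  · have h1 : softPos t - softPos 1 = ∫ τ in (1 : ℝ)..t, min (max τ 0) 1 :=
      intervalIntegral.integral_interval_sub_left
        (Continuous.intervalIntegrable (by fun_prop) _ _)
        (Continuous.intervalIntegrable (by fun_prop) _ _)
    rw [intervalIntegral.integral_congr (g := fun _ => 1), intervalIntegral.integral_const] at h1
    · simp only [smul_eq_mul, mul_one] at h1
      linarith [softPos_nonneg 1]
    · intro τ hτ
      rw [uIcc_of_le h] at hτ
      exact min_eq_right (hτ.1.trans (le_max_left _ _))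

theorem softPos_le {t : ℝ} (ht : 0 ≤ t) : softPos t ≤ t := by
  have := intervalIntegral.integral_mono_on (μ := volume) (f := fun τ : ℝ => min (max τ 0) 1)
    (g := fun _ => 1) ht (Continuous.intervalIntegrable (by fun_prop) _ _) (by simp)
    (fun τ _ => min_le_right _ _)
  simpa [softPos] using this

/-- The bilinear form `(ξ, η) ↦ ⟨Mξ, η⟩`. -/
def bilin (M : Matrix (Fin 2) (Fin 2) ℝ) (ξ η : Fin 2 → ℝ) : ℝ :=
  ∑ i, ∑ j, M i j * ξ j * η i

/-- The gradient of `φ` at `x`, in coordinates. -/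
def grad (φ : E2 → ℝ) (x : E2) : Fin 2 → ℝ := fun i => pd φ i x

theorem bilin_smul_left (M : Matrix (Fin 2) (Fin 2) ℝ) (a : ℝ) (ξ η : Fin 2 → ℝ) :
    bilin M (a • ξ) η = a * bilin M ξ η := by
  simp only [bilin, Fin.sum_univ_two, Pi.smul_apply, smul_eq_mul]
  ring

theorem bilin_smul_right (M : Matrix (Fin 2) (Fin 2) ℝ) (a : ℝ) (ξ η : Fin 2 → ℝ) :
    bilin M ξ (a • η) = a * bilin M ξ η := by
  simp only [bilin, Fin.sum_univ_two, Pi.smul_apply, smul_eq_mul]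
  ring

theorem bilin_add_right (M : Matrix (Fin 2) (Fin 2) ℝ) (ξ η ζ : Fin 2 → ℝ) :
    bilin M ξ (η + ζ) = bilin M ξ η + bilin M ξ ζ := by
  simp only [bilin, Fin.sum_univ_two, Pi.add_apply]
  ring

theorem grad_comp {g : ℝ → ℝ} {g' : ℝ} {P : E2 → ℝ} {x : E2} (hg : HasDerivAt g g' (P x))
    (hP : DifferentiableAt ℝ P x) : grad (fun y => g (P y)) x = g' • grad P x :=
  funext fun i => pd_comp hg hP i

theorem grad_mul {P Q : E2 → ℝ} {x : E2} (hP : DifferentiableAt ℝ P x)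
    (hQ : DifferentiableAt ℝ Q x) :
    grad (fun y => P y * Q y) x = P x • grad Q x + Q x • grad P x :=
  funext fun i => pd_mul hP hQ i

theorem grad_congr {P Q : E2 → ℝ} {x : E2} (h : P =ᶠ[nhds x] Q) : grad P x = grad Q x :=
  funext fun i => pd_congr h i

theorem grad_eq_zero_of_notMem_tsupport {P : E2 → ℝ} {x : E2} (h : x ∉ tsupport P) :
    grad P x = 0 :=
  funext fun i => by simp [grad, pd, fderiv_of_notMem_tsupport ℝ h]

theorem gradSq_of_grad_eq {P Q : E2 → ℝ} {x : E2} {a : ℝ} (h : grad Q x = a • grad P x) :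
    gradSq Q x = a ^ 2 * gradSq P x := by
  have h1 : ∀ i, pd Q i x = a * pd P i x := fun i => congrFun h i
  simp only [gradSq, h1, mul_pow, Finset.mul_sum]

/-- Continuous symmetric coefficients on the unit disc with ellipticity `Λ`. -/
structure IsElliptic (Λ : ℝ) (A : E2 → Matrix (Fin 2) (Fin 2) ℝ) : Prop where
  one_le : 1 ≤ Λ
  cont : ContinuousOn A (ball 0 1)
  symm : ∀ x ∈ ball (0 : E2) 1, (A x).IsSymm
  lower : ∀ x ∈ ball (0 : E2) 1, ∀ ξ : Fin 2 → ℝ, Λ⁻¹ * ∑ i, ξ i ^ 2 ≤ bilin (A x) ξ ξ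
  upper : ∀ x ∈ ball (0 : E2) 1, ∀ ξ : Fin 2 → ℝ, bilin (A x) ξ ξ ≤ Λ * ∑ i, ξ i ^ 2

theorem IsWeakSol.isElliptic {Λ κ : ℝ} {A : E2 → Matrix (Fin 2) (Fin 2) ℝ} {b f F φ : E2 → ℝ}
    (h : IsWeakSol Λ κ A b f F φ) (hΛ : 1 ≤ Λ) : IsElliptic Λ A :=
  ⟨hΛ, h.contA, h.symmA, h.ellip_lower, h.ellip_upper⟩

section
variable {Λ : ℝ} {A : E2 → Matrix (Fin 2) (Fin 2) ℝ}

theorem IsElliptic.two_mul_bilin_le (hA : IsElliptic Λ A) {x : E2} (hx : x ∈ ball (0 : E2) 1)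
    (ξ η : Fin 2 → ℝ) :
    2 * bilin (A x) ξ η ≤ 1 / 2 * bilin (A x) ξ ξ + 2 * bilin (A x) η η := by
  have h1 := hA.lower x hx (ξ - (2 : ℝ) • η)
  have h2 : 0 ≤ Λ⁻¹ * ∑ i, (ξ - (2 : ℝ) • η) i ^ 2 :=
    mul_nonneg (inv_nonneg.2 (zero_le_one.trans hA.one_le))
      (Finset.sum_nonneg fun i _ => sq_nonneg _)
  have h3 := (hA.symm x hx).apply 0 1
  simp only [bilin, Fin.sum_univ_two, Pi.sub_apply, Pi.smul_apply, smul_eq_mul] at h1 h2 ⊢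
  rw [h3] at *
  linarith

theorem IsElliptic.continuousOn_entry (hA : IsElliptic Λ A) (i j : Fin 2) :
    ContinuousOn (fun x => A x i j) (ball 0 1) :=
  (continuous_id.matrix_elem i j).comp_continuousOn hA.cont

theorem IsElliptic.continuousOn_bilin (hA : IsElliptic Λ A) {P Q : E2 → ℝ} {U : Set E2}
    (hU : IsOpen U) (hU1 : U ⊆ ball 0 1) (hP : ContDiffOn ℝ 1 P U) (hQ : ContDiffOn ℝ 1 Q U) :
    ContinuousOn (fun x => bilin (A x) (grad P x) (grad Q x)) U := by
  unfold bilin grad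
  refine continuousOn_finsetSum _ fun i _ => continuousOn_finsetSum _ fun j _ => ?_
  refine ContinuousOn.mul (ContinuousOn.mul ?_ (continuousOn_pd hU hP j)) (continuousOn_pd hU hQ i)
  exact (hA.continuousOn_entry i j).mono hU1

end

theorem integrableOn_of_eq_zero_off {g : E2 → ℝ} {U K : Set E2} (hU : IsOpen U) (hK : IsCompact K)
    (hKU : K ⊆ U) (hg : ContinuousOn g U) (h0 : ∀ x ∈ U, x ∉ K → g x = 0) : IntegrableOn g U :=
  ((hg.mono hKU).integrableOn_compact hK).of_forall_sdiff_eq_zero hU.measurableSet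
    fun x hx => h0 x hx.1 hx.2

theorem contDiff_of_eq_zero_off {ψ : E2 → ℝ} {U K : Set E2} (hU : IsOpen U) (hK : IsClosed K)
    (hKU : K ⊆ U) (h : ContDiffOn ℝ 1 ψ U) (h0 : ∀ x ∉ K, ψ x = 0) : ContDiff ℝ 1 ψ := by
  rw [contDiff_iff_contDiffAt]
  intro x
  by_cases hx : x ∈ K
  · exact h.contDiffAt (hU.mem_nhds (hKU hx))
  · refine (contDiffAt_const (c := 0)).congr_of_eventuallyEq ?_
    filter_upwards [hK.isOpen_compl.mem_nhds hx] with y hy using h0 y hy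

theorem tsupport_subset_of_eq_zero_off {ψ : E2 → ℝ} {K : Set E2} (hK : IsClosed K)
    (h0 : ∀ x ∉ K, ψ x = 0) : tsupport ψ ⊆ K :=
  closure_minimal (fun x hx => by_contra fun h => hx (h0 x h)) hK

/-- `P` satisfies `-div (A ∇P) ≤ L` weakly on the unit disc. -/
structure IsSub (A : E2 → Matrix (Fin 2) (Fin 2) ℝ) (L : ℝ) (P : E2 → ℝ) : Prop where
  smooth : ContDiffOn ℝ 1 P (ball 0 1)
  le : ∀ ψ : E2 → ℝ, ContDiff ℝ 1 ψ → HasCompactSupport ψ → tsupport ψ ⊆ ball 0 1 →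
    (∀ x, 0 ≤ ψ x) →
    ∫ x in ball (0 : E2) 1, bilin (A x) (grad P x) (grad ψ x) ≤ L * ∫ x in ball (0 : E2) 1, ψ x

theorem IsWeakSol.abs_rhs_le {Λ κ : ℝ} {A : E2 → Matrix (Fin 2) (Fin 2) ℝ} {b f F φ : E2 → ℝ}
    (h : IsWeakSol Λ κ A b f F φ) (hΛ : 1 ≤ Λ) (hκ : 0 < κ) {x : E2} (hx : x ∈ ball (0 : E2) 1) :
    |b x * (1 - (1 / 2) * f x * Real.exp (φ x) + F x)| ≤
      Λ * gradSq φ x + 3 * Λ * Real.exp κ := by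
  have hb : |b x| ≤ Λ := by
    have := h.b_lower x hx
    have h2 : 0 ≤ Λ⁻¹ := inv_nonneg.2 (zero_le_one.trans hΛ)
    rw [abs_of_nonneg (h2.trans this)]
    exact h.b_upper x hx
  have h1 : Real.exp (φ x) ≤ Real.exp κ := Real.exp_le_exp.2 (h.φ_le_κ x hx)
  have h2 : 1 ≤ Real.exp κ := Real.one_le_exp hκ.le
  have h3 : f x * Real.exp (φ x) ≤ Real.exp κ := by
    have := mul_le_mul (h.f_le_one x hx) h1 (Real.exp_pos _).le zero_le_one
    linarith
  have h4 : 0 ≤ f x * Real.exp (φ x) := mul_nonneg (h.f_nonneg x hx) (Real.exp_pos _).le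
  have h5 := abs_le.1 (h.F_bound x hx)
  have h6 : |1 - (1 / 2) * f x * Real.exp (φ x) + F x| ≤ gradSq φ x + 3 * Real.exp κ :=
    abs_le.2 ⟨by linarith [h5.1], by linarith [h5.2]⟩
  rw [abs_mul]
  calc _ ≤ Λ * (gradSq φ x + 3 * Real.exp κ) :=
        mul_le_mul hb h6 (abs_nonneg _) (zero_le_one.trans hΛ)
    _ = _ := by ring

theorem IsWeakSol.isSub_exp {Λ κ : ℝ} {A : E2 → Matrix (Fin 2) (Fin 2) ℝ} {b f F φ : E2 → ℝ}
    (h : IsWeakSol Λ κ A b f F φ) (hΛ : 1 ≤ Λ) (hκ : 0 < κ) {a : ℝ} (ha : |a| = Λ ^ 2) :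
    IsSub A (3 * Λ ^ 3 * Real.exp ((Λ ^ 2 + 1) * κ)) (fun x => Real.exp (a * φ x)) := by
  have hA := h.isElliptic hΛ
  have hP : ContDiffOn ℝ 1 (fun x => Real.exp (a * φ x)) (ball 0 1) :=
    (contDiffOn_const.mul h.smooth_φ).exp
  refine ⟨hP, fun ψ hψ hc hs h0 => ?_⟩
  set g : E2 → ℝ := fun x => b x * (1 - (1 / 2) * f x * Real.exp (φ x) + F x) with hgdef
  have hφc := h.smooth_φ.continuousOn
  have hg : ContinuousOn g (ball 0 1) :=
    h.contb.mul ((continuousOn_const.sub ((continuousOn_const.mul h.contf).mul hφc.rexp)).add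
      h.contF)
  set P : E2 → ℝ := fun x => Real.exp (a * φ x) with hPdef
  set ψ' : E2 → ℝ := fun x => P x * ψ x with hψ'def
  have hz : ∀ x ∉ tsupport ψ, ψ' x = 0 := fun x hx => by
    simp [ψ', image_eq_zero_of_notMem_tsupport hx]
  have hψ' : ContDiff ℝ 1 ψ' := contDiff_of_eq_zero_off isOpen_ball (isClosed_tsupport ψ) hs
    (hP.mul hψ.contDiffOn) hz
  have hs' := tsupport_subset_of_eq_zero_off (isClosed_tsupport ψ) hz
  have hc' : HasCompactSupport ψ' := HasCompactSupport.intro hc.isCompact hz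
  have hweak := weak_eq_of_contDiff_one (V := fun i x => ∑ j, A x i j * pd φ j x) (g := g)
    (fun i => continuousOn_finsetSum _ fun j _ => ContinuousOn.mul
      (hA.continuousOn_entry i j) (continuousOn_pd isOpen_ball h.smooth_φ j)) hg
    (fun ψ h1 h2 h3 => by simpa only [Finset.sum_mul] using h.weak_eq ψ h1 h2 h3) hψ' hc'
    (hs'.trans hs)
  simp only [Finset.sum_mul] at hweak
  change ∫ x in ball (0 : E2) 1, bilin (A x) (grad φ x) (grad ψ' x) = _ at hweak
  have hφd : ∀ x ∈ ball (0 : E2) 1, DifferentiableAt ℝ φ x := fun x hx =>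
    (h.smooth_φ.contDiffAt (isOpen_ball.mem_nhds hx)).differentiableAt one_ne_zero
  have hgP : ∀ x ∈ ball (0 : E2) 1, grad P x = (a * P x) • grad φ x := fun x hx =>
    grad_comp (g := fun t => Real.exp (a * t))
      (by simpa [mul_comm] using ((hasDerivAt_id (φ x)).const_mul a).exp) (hφd x hx)
  have hgψ' : ∀ x ∈ ball (0 : E2) 1, grad ψ' x = P x • grad ψ x + ψ x • grad P x := fun x hx =>
    grad_mul ((hP.contDiffAt (isOpen_ball.mem_nhds hx)).differentiableAt one_ne_zero)
      (hψ.differentiable one_ne_zero x)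
  have hpt : ∀ x ∈ ball (0 : E2) 1, bilin (A x) (grad P x) (grad ψ x) =
      a * bilin (A x) (grad φ x) (grad ψ' x) -
        a ^ 2 * (ψ' x * bilin (A x) (grad φ x) (grad φ x)) := fun x hx => by
    rw [hgψ' x hx, hgP x hx]
    simp only [bilin_smul_left, bilin_smul_right, bilin_add_right, ψ']
    ring
  have hi1 : IntegrableOn (fun x => bilin (A x) (grad φ x) (grad ψ' x)) (ball 0 1) :=
    integrableOn_of_eq_zero_off isOpen_ball hc (hs) (hA.continuousOn_bilin isOpen_ball
      subset_rfl h.smooth_φ hψ'.contDiffOn) fun x _ hx => by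
        rw [grad_eq_zero_of_notMem_tsupport fun hx' => hx (hs' hx')]
        simp [bilin]
  have hi2 : IntegrableOn (fun x => ψ' x * bilin (A x) (grad φ x) (grad φ x)) (ball 0 1) :=
    integrableOn_of_eq_zero_off isOpen_ball hc hs (hψ'.continuous.continuousOn.mul
      (hA.continuousOn_bilin isOpen_ball subset_rfl h.smooth_φ h.smooth_φ)) fun x _ hx => by
        rw [hz x hx, zero_mul]
  have hi3 : IntegrableOn (fun x => g x * ψ' x) (ball 0 1) :=
    integrableOn_of_eq_zero_off isOpen_ball hc hs (hg.mul hψ'.continuous.continuousOn)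
      fun x _ hx => by rw [hz x hx, mul_zero]
  have hi4 : IntegrableOn ψ (ball 0 1) :=
    (hψ.continuous.integrable_of_hasCompactSupport hc).integrableOn
  rw [setIntegral_congr_fun measurableSet_ball hpt, integral_sub (hi1.const_mul _)
    (hi2.const_mul _), integral_const_mul, hweak, ← integral_const_mul,
    ← integral_sub (hi3.const_mul _) (hi2.const_mul _), ← integral_const_mul]
  refine setIntegral_mono_on ((hi3.const_mul _).sub (hi2.const_mul _)) (hi4.const_mul _)
    measurableSet_ball fun x hx => ?_
  have hb := h.abs_rhs_le hΛ hκ hx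
  have hΛ0 : 0 < Λ := by linarith
  have hP0 : 0 < P x := Real.exp_pos _
  have hψ0 : 0 ≤ ψ' x := mul_nonneg hP0.le (h0 x)
  have hPle : P x ≤ Real.exp (Λ ^ 2 * κ) := by
    apply Real.exp_le_exp.2
    rw [← ha]
    exact mul_le_mul (le_abs_self a) (h.φ_le_κ x hx) (h.φ_nonneg x hx) (abs_nonneg _)
  have hagψ : a * (g x * ψ' x) ≤ Λ ^ 2 * (Λ * gradSq φ x + 3 * Λ * Real.exp κ) * ψ' x := by
    rw [← mul_assoc]
    refine mul_le_mul_of_nonneg_right ((le_abs_self _).trans ?_) hψ0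
    rw [abs_mul, ha]
    exact mul_le_mul_of_nonneg_left hb (by positivity)
  have ha2 : a ^ 2 = Λ ^ 4 := by rw [← sq_abs, ha]; ring
  have hq : Λ ^ 3 * gradSq φ x ≤ Λ ^ 4 * bilin (A x) (grad φ x) (grad φ x) := by
    have h1 := mul_le_mul_of_nonneg_left (hA.lower x hx (grad φ x)) (by positivity : 0 ≤ Λ ^ 4)
    calc _ = Λ ^ 4 * (Λ⁻¹ * gradSq φ x) := by field_simp
      _ ≤ _ := h1
  have h5 : a ^ 2 * (ψ' x * bilin (A x) (grad φ x) (grad φ x)) ≥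
      Λ ^ 3 * gradSq φ x * ψ' x := by
    rw [ha2]
    nlinarith
  have h6 : ψ' x ≤ Real.exp (Λ ^ 2 * κ) * ψ x := mul_le_mul_of_nonneg_right hPle (h0 x)
  calc _ ≤ 3 * Λ ^ 3 * Real.exp κ * ψ' x := by linarith
    _ ≤ 3 * Λ ^ 3 * Real.exp κ * (Real.exp (Λ ^ 2 * κ) * ψ x) := by gcongr
    _ = _ := by rw [add_mul, one_mul, Real.exp_add]; ring

theorem setIntegral_one_ball (c : E2) {r : ℝ} (hr : 0 ≤ r) :
    ∫ _ in ball c r, (1 : ℝ) = Real.pi * r ^ 2 := by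
  rw [setIntegral_const, smul_eq_mul, mul_one, Measure.real, EuclideanSpace.volume_ball_fin_two,
    ENNReal.toReal_mul, ENNReal.toReal_pow, ENNReal.toReal_ofReal hr]
  simp [mul_comm, Real.pi_pos.le]

section
variable {Λ L : ℝ} {A : E2 → Matrix (Fin 2) (Fin 2) ℝ} {P : E2 → ℝ}

/-- A Caccioppoli estimate combined with the Poincaré inequality. -/
theorem integral_gradSq_le_of_energy (hΛ : 1 ≤ Λ) (hL : 0 < L) {u : E2 → ℝ} (hu : ContDiff ℝ 1 u)
    {c : E2} {r : ℝ} (hr : 0 < r) (h0 : ∀ x ∉ ball c r, u x = 0)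
    (hE : ∫ x, gradSq u x ≤ Λ * L * ∫ x, u x) :
    ∫ x, gradSq u x ≤ 4 * Real.pi * (Λ * L * r ^ 2) ^ 2 := by
  have h0' : ∀ x ∉ closedBall c r, u x = 0 := fun x hx =>
    h0 x fun h => hx (ball_subset_closedBall h)
  have hcs : HasCompactSupport u := HasCompactSupport.intro (isCompact_closedBall c r) h0'
  have hP := integral_sq_le_gradSq hu h0'
  set m := Λ * L * r ^ 2 with hm
  have hm0 : 0 < m := by positivity
  have hui := hu.continuous.integrable_of_hasCompactSupport hcs (μ := volume)
  have hsi := integrable_sq_of_hasCompactSupport hu.continuous hcs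
  have hbi : Integrable ((ball c r).indicator fun _ => (1 : ℝ)) := by
    refine IntegrableOn.integrable_indicator ?_ measurableSet_ball
    exact integrableOn_const measure_ball_lt_top.ne
  have h1 : ∫ x, u x ≤ ∫ x, ((1 / (8 * m)) * u x ^ 2 +
      (2 * m) * (ball c r).indicator (fun _ => (1 : ℝ)) x) := by
    refine integral_mono hui ((hsi.const_mul _).add (hbi.const_mul _)) fun x => ?_
    by_cases hx : x ∈ ball c r
    · simp only [indicator_of_mem hx]
      have : (1 / (8 * m)) * u x ^ 2 + 2 * m * 1 - u x = (1 / (8 * m)) * (u x - 4 * m) ^ 2 := by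
        field_simp; ring
      have h2 : 0 ≤ (1 / (8 * m)) * (u x - 4 * m) ^ 2 := by positivity
      linarith
    · simp [h0 x hx, indicator_of_notMem hx]
  rw [integral_add (hsi.const_mul _) (hbi.const_mul _), integral_const_mul, integral_const_mul,
    integral_indicator measurableSet_ball, setIntegral_one_ball c hr.le] at h1
  set E := ∫ x, gradSq u x
  set S := ∫ x, u x ^ 2
  have h2 : E ≤ Λ * L * ((1 / (8 * m)) * (4 * r ^ 2 * E) + 2 * m * (Real.pi * r ^ 2)) :=
    hE.trans (mul_le_mul_of_nonneg_left (h1.trans (by gcongr)) (by positivity))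
  have h3 : Λ * L * ((1 / (8 * m)) * (4 * r ^ 2 * E) + 2 * m * (Real.pi * r ^ 2)) =
      E / 2 + 2 * Real.pi * m ^ 2 := by
    rw [hm]
    field_simp
    ring
  linarith

theorem exists_circle_le_of_isSub (hA : IsElliptic Λ A) (hP : IsSub A L P) (hL : 0 < L) {c : E2}
    {r : ℝ} (hr : 0 < r) (hs : closedBall c r ⊆ ball 0 1) {k : ℝ} (hk : ∀ z ∈ sphere c r, P z ≤ k) :
    ∃ ρ ∈ Ioo (r / 4) (r / 2), ∀ z ∈ sphere c ρ, P z ≤ k + 102 * Λ * L * r ^ 2 := by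
  have hΛ := hA.one_le
  set δ := L * r ^ 2 with hδ
  have hδ0 : 0 < δ := by positivity
  set t : E2 → ℝ := fun x => (P x - (k + δ)) / δ with ht
  set u : E2 → ℝ := (ball c r).indicator fun x => δ * softPos (t x) with hu
  set K : Set E2 := closedBall c r ∩ P ⁻¹' Ici (k + δ) with hKdef
  have hbU : ball c r ⊆ ball 0 1 := ball_subset_closedBall.trans hs
  have hKcl : IsClosed K :=
    (hP.smooth.continuousOn.mono hs).preimage_isClosed_of_isClosed isClosed_closedBall isClosed_Ici
  have hKc : IsCompact K := (isCompact_closedBall c r).of_isClosed_subset hKcl inter_subset_left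
  have hKb : K ⊆ ball c r := fun x hx => by
    refine mem_ball.2 (lt_of_le_of_ne (mem_closedBall.1 hx.1) fun he => ?_)
    have h1 := hk x he
    have h2 : k + δ ≤ P x := hx.2
    linarith
  have hu0 : ∀ x ∉ K, u x = 0 := fun x hx => by
    by_cases hxb : x ∈ ball c r
    · have h1 : P x < k + δ := lt_of_not_ge fun h => hx ⟨ball_subset_closedBall hxb, h⟩
      simp only [u, indicator_of_mem hxb]
      rw [softPos_of_nonpos (div_nonpos_of_nonpos_of_nonneg (by linarith) hδ0.le), mul_zero]
    · simp [u, hxb]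
  have hub : ∀ x ∉ ball c r, u x = 0 := fun x hx => by simp [u, hx]
  have hunn : ∀ x, 0 ≤ u x := fun x =>
    indicator_nonneg (fun y _ => mul_nonneg hδ0.le (softPos_nonneg _)) x
  have hP1 := hP.smooth.mono hbU
  have htc : ContDiffOn ℝ 1 t (ball c r) := (hP1.sub contDiffOn_const).div_const δ
  have huc : ContDiff ℝ 1 u := contDiff_of_eq_zero_off isOpen_ball hKcl hKb
    (((contDiffOn_const (c := δ)).mul (contDiff_softPos.comp_contDiffOn htc)).congr fun x hx => by
      simp only [u, indicator_of_mem hx, Function.comp_apply]) hu0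
  have hus := tsupport_subset_of_eq_zero_off hKcl hu0
  have hcs : HasCompactSupport u := HasCompactSupport.intro hKc hu0
  have hgu : ∀ x ∉ ball c r, grad u x = 0 := fun x hx =>
    grad_eq_zero_of_notMem_tsupport fun h => hx (hKb (hus h))
  have hgu0 : ∀ x ∉ ball c r, gradSq u x = 0 := fun x hx => by
    rw [gradSq_of_grad_eq (P := u) (a := 0) (by rw [hgu x hx, zero_smul])]
    simp
  have hpt : ∀ x ∈ ball (0 : E2) 1,
      Λ⁻¹ * gradSq u x ≤ bilin (A x) (grad P x) (grad u x) := fun x hx => by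
    by_cases hxb : x ∈ ball c r
    · have hPd := (hP.smooth.contDiffAt (isOpen_ball.mem_nhds hx)).differentiableAt one_ne_zero
      have hd : HasDerivAt (fun p => δ * softPos ((p - (k + δ)) / δ))
          (min (max (t x) 0) 1) (P x) := by
        have h1 : HasDerivAt (fun p : ℝ => (p - (k + δ)) / δ) (1 / δ) (P x) :=
          ((hasDerivAt_id _).sub_const _).div_const _
        have h2 := ((hasDerivAt_softPos (t x)).comp (P x) h1).const_mul δ
        rwa [show δ * (min (max (t x) 0) 1 * (1 / δ)) = min (max (t x) 0) 1 by
          field_simp] at h2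
      have he : u =ᶠ[nhds x] fun y => δ * softPos ((P y - (k + δ)) / δ) := by
        filter_upwards [isOpen_ball.mem_nhds hxb] with y hy
        simp [u, indicator_of_mem hy, t]
      have hg := (grad_congr he).trans (grad_comp (P := P)
        (g := fun p => δ * softPos ((p - (k + δ)) / δ)) hd hPd)
      set m := min (max (t x) 0) 1
      have hm0 : 0 ≤ m := le_min (le_max_right _ _) zero_le_one
      have hm1 : m ≤ 1 := min_le_right _ _
      have hq := hA.lower x hx (grad P x)
      have hq' : Λ⁻¹ * gradSq P x ≤ bilin (A x) (grad P x) (grad P x) := hq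
      have hq0 : 0 ≤ Λ⁻¹ * gradSq P x :=
        mul_nonneg (inv_nonneg.2 (by linarith)) (gradSq_nonneg _ _)
      rw [gradSq_of_grad_eq hg, hg, bilin_smul_right]
      calc _ = m * (m * (Λ⁻¹ * gradSq P x)) := by ring
        _ ≤ m * (1 * bilin (A x) (grad P x) (grad P x)) := by gcongr
        _ = _ := by rw [one_mul]
    · rw [hgu0 x hxb, hgu x hxb]
      simp [bilin]
  have hgi := integrable_gradSq huc hcs
  have hbi : IntegrableOn (fun x => bilin (A x) (grad P x) (grad u x)) (ball 0 1) :=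
    integrableOn_of_eq_zero_off isOpen_ball hKc (hKb.trans hbU)
      (hA.continuousOn_bilin isOpen_ball subset_rfl hP.smooth huc.contDiffOn) fun x _ hx => by
        rw [grad_eq_zero_of_notMem_tsupport fun h => hx (hus h)]
        simp [bilin]
  have hmain : Λ⁻¹ * ∫ x, gradSq u x ≤ L * ∫ x, u x := by
    have h1 := hP.le u huc hcs (hus.trans (hKb.trans hbU)) hunn
    have h2 := setIntegral_mono_on (hgi.integrableOn.const_mul Λ⁻¹) hbi measurableSet_ball hpt
    rw [integral_const_mul, setIntegral_eq_integral_of_forall_compl_eq_zero fun x hx =>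
      hgu0 x fun h => hx (hbU h)] at h2
    rw [setIntegral_eq_integral_of_forall_compl_eq_zero (f := u) fun x hx =>
      hub x fun h => hx (hbU h)] at h1
    exact h2.trans h1
  have hE : ∫ x, gradSq u x ≤ Λ * L * ∫ x, u x := by
    rw [inv_mul_le_iff₀ (by linarith)] at hmain
    linarith
  have hEle := integral_gradSq_le_of_energy hΛ hL huc hr hub hE
  have hSle := integral_sq_le_gradSq huc (c := c) (r := r) fun x hx =>
    hub x fun h => hx (ball_subset_closedBall h)
  obtain ⟨ρ, hρ, hz⟩ := exists_circle_sq_le huc c (half_pos hr)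
  refine ⟨ρ, ⟨by linarith [hρ.1], hρ.2⟩, fun z hzs => ?_⟩
  have hzb : z ∈ ball c r := by
    rw [mem_ball, mem_sphere.1 hzs]
    linarith [hρ.2]
  have hsi := integrable_sq_of_hasCompactSupport huc.continuous hcs
  have h1 : ∫ x in ball c (r / 2), (gradSq u x + u x ^ 2 / (r / 2) ^ 2) ≤
      ∫ x, (gradSq u x + u x ^ 2 / (r / 2) ^ 2) :=
    setIntegral_le_integral (hgi.add (hsi.div_const _))
      (Filter.Eventually.of_forall fun x => add_nonneg (gradSq_nonneg _ _) (by positivity))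
  rw [integral_add hgi (hsi.div_const _), integral_div] at h1
  set E := ∫ x, gradSq u x
  set S := ∫ x, u x ^ 2
  set m := Λ * L * r ^ 2
  have h2 : S / (r / 2) ^ 2 ≤ 16 * E := by
    rw [div_le_iff₀ (by positivity)]
    linarith
  have h3 : u z ^ 2 ≤ (100 * m) ^ 2 := by
    have := hz z hzs
    nlinarith [Real.pi_lt_d2, sq_nonneg m]
  have hm0 : 0 < m := by positivity
  have h4 : u z ≤ 100 * m := (abs_le_of_sq_le_sq' h3 (by positivity)).2
  have h5 : P z - (k + δ) - δ ≤ u z := by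
    simp only [u, indicator_of_mem hzb]
    have h6 := mul_le_mul_of_nonneg_left (sub_one_le_softPos (t z)) hδ0.le
    have h7 : δ * (t z - 1) = P z - (k + δ) - δ := by
      simp only [t]
      field_simp
    linarith
  have h8 : δ ≤ m := by
    simp only [δ, m]
    nlinarith
  linarith

/-- Weak maximum principle at the centre of a disc. -/
theorem IsSub.center_le (hP : IsSub A L P) (hA : IsElliptic Λ A) (hL : 0 < L) {c : E2}
    {r : ℝ} (hr : 0 < r) (hs : closedBall c r ⊆ ball 0 1) {k : ℝ} (hk : ∀ z ∈ sphere c r, P z ≤ k) :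
    P c ≤ k + 136 * Λ * L * r ^ 2 := by
  have hΛ := hA.one_le
  have key : ∀ n : ℕ, ∃ ρ ∈ Ioc 0 (r / 2 ^ n), ∀ z ∈ sphere c ρ,
      P z ≤ k + 136 * Λ * L * r ^ 2 * (1 - (1 / 4) ^ n) := by
    intro n
    induction n with
    | zero => exact ⟨r, ⟨hr, by simp⟩, by simpa using hk⟩
    | succ n ih =>
      obtain ⟨ρ, hρ, h⟩ := ih
      have hρr : ρ ≤ r := hρ.2.trans (div_le_self hr.le (one_le_pow₀ one_le_two))
      obtain ⟨ρ', hρ', h'⟩ := exists_circle_le_of_isSub hA hP hL hρ.1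
        ((closedBall_subset_closedBall hρr).trans hs) h
      refine ⟨ρ', ⟨by linarith [hρ'.1, hρ.1], ?_⟩, fun z hz => (h' z hz).trans ?_⟩
      · rw [pow_succ, ← div_div]
        linarith [hρ'.2, hρ.2]
      · have h1 : ρ ^ 2 ≤ r ^ 2 * (1 / 4) ^ n := by
          calc ρ ^ 2 ≤ (r / 2 ^ n) ^ 2 := pow_le_pow_left₀ hρ.1.le hρ.2 2
            _ = _ := by
              rw [div_pow, ← pow_mul, mul_comm n 2, pow_mul, one_div, inv_pow]
              norm_num [div_eq_mul_inv]
        have h2 : 102 * Λ * L * ρ ^ 2 ≤ 102 * Λ * L * (r ^ 2 * (1 / 4) ^ n) := by gcongr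
        rw [pow_succ (1 / 4 : ℝ) n]
        linarith
  by_contra! hlt
  have hc : ContinuousAt P c := hP.smooth.continuousOn.continuousAt
    (isOpen_ball.mem_nhds (hs (mem_closedBall_self hr.le)))
  obtain ⟨ε, hε, hball⟩ := Metric.mem_nhds_iff.1 (hc.eventually (lt_mem_nhds hlt))
  obtain ⟨n, hn⟩ := exists_pow_lt_of_lt_one (div_pos hε hr) (one_half_lt_one (α := ℝ))
  obtain ⟨ρ, hρ, h⟩ := key n
  obtain ⟨z, hz⟩ := (NormedSpace.sphere_nonempty (x := c)).2 hρ.1.le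
  have h1 : z ∈ ball c ε := by
    rw [mem_ball, mem_sphere.1 hz]
    refine hρ.2.trans_lt ?_
    rw [lt_div_iff₀ hr] at hn
    rw [div_pow, one_pow] at hn
    rw [div_eq_mul_one_div]
    linarith
  have h2 : k + 136 * Λ * L * r ^ 2 < P z := hball h1
  have h3 := h z hz
  have h4 : 0 ≤ 136 * Λ * L * r ^ 2 * (1 / 4) ^ n := by positivity
  linarith

end

/-- A cutoff function adapted to the disc of radius `R` around `c`. -/
def cutoff (c : E2) (R : ℝ) (x : E2) : ℝ := softPos (2 * (1 - ‖x - c‖ ^ 2 / R ^ 2))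

theorem contDiff_cutoff (c : E2) (R : ℝ) : ContDiff ℝ 1 (cutoff c R) := by
  refine contDiff_softPos.comp (contDiff_const.mul (contDiff_const.sub (ContDiff.div_const ?_ _)))
  exact (contDiff_id.sub contDiff_const).norm_sq ℝ

theorem cutoff_nonneg (c : E2) (R : ℝ) (x : E2) : 0 ≤ cutoff c R x := softPos_nonneg _

theorem cutoff_eq_zero {c x : E2} {R : ℝ} (hR : 0 < R) (hx : x ∉ closedBall c R) :
    cutoff c R x = 0 := by
  rw [mem_closedBall, dist_eq_norm, not_le] at hx
  apply softPos_of_nonpos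
  have : 1 ≤ ‖x - c‖ ^ 2 / R ^ 2 := by
    rw [one_le_div (by positivity)]
    exact pow_le_pow_left₀ hR.le hx.le 2
  linarith

theorem cutoff_le_two {c x : E2} {R : ℝ} (hR : 0 < R) (hx : x ∈ closedBall c R) :
    cutoff c R x ≤ 2 := by
  rw [mem_closedBall, dist_eq_norm] at hx
  have h1 : ‖x - c‖ ^ 2 / R ^ 2 ≤ 1 := by
    rw [div_le_one (by positivity)]
    exact pow_le_pow_left₀ (norm_nonneg _) hx 2
  have h2 : 0 ≤ ‖x - c‖ ^ 2 / R ^ 2 := by positivity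
  exact (softPos_le (by linarith)).trans (by linarith)

theorem half_le_cutoff {c x : E2} {R : ℝ} (hR : 0 < R) (hx : x ∈ ball c (R / 2)) :
    1 / 2 ≤ cutoff c R x := by
  rw [mem_ball, dist_eq_norm] at hx
  have h1 : ‖x - c‖ ^ 2 / R ^ 2 ≤ 1 / 4 := by
    rw [div_le_iff₀ (by positivity)]
    have := pow_le_pow_left₀ (norm_nonneg _) hx.le 2
    linarith
  exact le_trans (by linarith) (sub_one_le_softPos _)

theorem gradSq_cutoff_le {c x : E2} {R : ℝ} (hR : 0 < R) (hx : x ∈ closedBall c R) :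
    gradSq (cutoff c R) x ≤ 16 / R ^ 2 := by
  have hf : HasFDerivAt (fun y : E2 => ‖y - c‖ ^ 2)
      (2 • (innerSL ℝ (x - c)).comp (ContinuousLinearMap.id ℝ E2)) x :=
    ((hasFDerivAt_id x).sub_const c).norm_sq
  have hp : ∀ i, pd (fun y : E2 => ‖y - c‖ ^ 2) i x = 2 * (x i - c i) := fun i => by
    unfold pd
    rw [hf.fderiv]
    simp [EuclideanSpace.inner_single_right]
  set q : ℝ → ℝ := fun t => softPos (2 * (1 - t / R ^ 2)) with hq
  set m := min (max (2 * (1 - ‖x - c‖ ^ 2 / R ^ 2)) 0) 1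
  have hd : HasDerivAt q (m * (2 * -(1 / R ^ 2))) (‖x - c‖ ^ 2) :=
    (hasDerivAt_softPos _).comp (‖x - c‖ ^ 2)
      ((((hasDerivAt_id _).div_const _).const_sub 1).const_mul 2)
  have hg : grad (cutoff c R) x = _ := grad_comp (g := q) hd hf.differentiableAt
  rw [gradSq_of_grad_eq hg]
  have h1 : gradSq (fun y : E2 => ‖y - c‖ ^ 2) x = 4 * ‖x - c‖ ^ 2 := by
    simp only [gradSq, hp]
    simp only [EuclideanSpace.norm_sq_eq, Fin.sum_univ_two, PiLp.sub_apply,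
      Real.norm_eq_abs, sq_abs]
    ring
  rw [h1]
  have hm0 : 0 ≤ m := le_min (le_max_right _ _) zero_le_one
  have hm1 : m ≤ 1 := min_le_right _ _
  have hm2 : m ^ 2 ≤ 1 := pow_le_one₀ hm0 hm1
  rw [mem_closedBall, dist_eq_norm] at hx
  have h2 := pow_le_pow_left₀ (norm_nonneg _) hx 2
  calc _ = m ^ 2 * (16 * ‖x - c‖ ^ 2 / (R ^ 2) ^ 2) := by ring
    _ ≤ 1 * (16 * R ^ 2 / (R ^ 2) ^ 2) := by gcongr
    _ = _ := by field_simp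

section
variable {Λ L : ℝ} {A : E2 → Matrix (Fin 2) (Fin 2) ℝ} {P : E2 → ℝ}

theorem setIntegral_const_closedBall (c : E2) {r : ℝ} (hr : 0 ≤ r) (a : ℝ) :
    ∫ _ in closedBall c r, a = Real.pi * r ^ 2 * a := by
  rw [setIntegral_const, smul_eq_mul, Measure.real, EuclideanSpace.volume_closedBall_fin_two,
    ENNReal.toReal_mul, ENNReal.toReal_pow, ENNReal.toReal_ofReal hr]
  simp [mul_comm, Real.pi_pos.le]

theorem contDiffOn_log_sub {U : Set E2} (hP : ContDiffOn ℝ 1 P U) {k : ℝ}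
    (hw : ∀ x ∈ U, 0 < k - P x) : ContDiffOn ℝ 1 (fun x => Real.log (k - P x)) U :=
  (contDiffOn_const.sub hP).log fun x hx => (hw x hx).ne'

/-- Logarithmic Caccioppoli estimate. -/
theorem IsSub.integral_gradSq_log_le (hP : IsSub A L P) (hA : IsElliptic Λ A) (hL : 0 < L)
    {c : E2} {R : ℝ} (hR : 0 < R) (hs : closedBall c R ⊆ ball 0 1) {k : ℝ}
    (hk : ∀ z ∈ closedBall c R, P z + L * R ^ 2 ≤ k) :
    ∫ x in ball c (R / 2), gradSq (fun y => Real.log (k - P y)) x ≤ 288 * Real.pi * Λ ^ 2 := by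
  have hΛ := hA.one_le
  have hΛ0 : 0 < Λ := by linarith
  set K := closedBall c R with hK
  have hKc : IsCompact K := isCompact_closedBall c R
  have hKcl : IsClosed K := isClosed_closedBall
  set δ := L * R ^ 2 with hδ
  have hδ0 : 0 < δ := by positivity
  set U : Set E2 := ball 0 1 ∩ P ⁻¹' Iio k with hUdef
  have hUo : IsOpen U := hP.smooth.continuousOn.isOpen_inter_preimage isOpen_ball isOpen_Iio
  have hUb : U ⊆ ball 0 1 := inter_subset_left
  have hKU : K ⊆ U := fun x hx => ⟨hs hx, by
    have := hk x hx
    change P x < k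
    linarith⟩
  have hPU := hP.smooth.mono hUb
  have hw : ∀ x ∈ U, 0 < k - P x := fun x hx => sub_pos.2 hx.2
  set v : E2 → ℝ := fun y => Real.log (k - P y) with hv
  have hvc : ContDiffOn ℝ 1 v U := contDiffOn_log_sub hPU hw
  set η := cutoff c R with hη
  have hηc : ContDiff ℝ 1 η := contDiff_cutoff c R
  set ψ : E2 → ℝ := fun x => η x ^ 2 * (k - P x)⁻¹ with hψdef
  have hψ0 : ∀ x ∉ K, ψ x = 0 := fun x hx => by
    simp only [ψ, η]
    rw [cutoff_eq_zero hR hx]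
    simp
  have hwi : ContDiffOn ℝ 1 (fun x => (k - P x)⁻¹) U :=
    (contDiffOn_const.sub hPU).inv fun x hx => (hw x hx).ne'
  have hψc : ContDiff ℝ 1 ψ :=
    contDiff_of_eq_zero_off hUo hKcl hKU ((hηc.pow 2).contDiffOn.mul hwi) hψ0
  have hψs := tsupport_subset_of_eq_zero_off hKcl hψ0
  have hψcs : HasCompactSupport ψ := HasCompactSupport.intro hKc hψ0
  have hψnn : ∀ x, 0 ≤ ψ x := fun x => by
    by_cases hx : x ∈ K
    · exact mul_nonneg (sq_nonneg _) (inv_nonneg.2 (hw x (hKU hx)).le)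
    · rw [hψ0 x hx]
  have hsub := hP.le ψ hψc hψcs (hψs.trans hs) hψnn
  have hz : ∀ x ∉ K, bilin (A x) (grad P x) (grad ψ x) = 0 := fun x hx => by
    rw [grad_eq_zero_of_notMem_tsupport fun h => hx (hψs h)]
    simp [bilin]
  rw [setIntegral_eq_of_subset_of_forall_sdiff_eq_zero measurableSet_ball hs
      (fun x hx => hz x hx.2),
    setIntegral_eq_of_subset_of_forall_sdiff_eq_zero measurableSet_ball hs
      (fun x hx => hψ0 x hx.2)] at hsub
  have hlow : ∀ x ∈ K, 1 / 2 * Λ⁻¹ * (η x ^ 2 * gradSq v x) - 32 * Λ / R ^ 2 ≤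
      bilin (A x) (grad P x) (grad ψ x) := fun x hx => by
    have hxU := hKU hx
    have hx1 := hUb hxU
    have hw0 := hw x hxU
    have hPd := (hP.smooth.contDiffAt (isOpen_ball.mem_nhds hx1)).differentiableAt one_ne_zero
    have hηd := hηc.differentiable one_ne_zero x
    set ω := (k - P x)⁻¹
    have hd1 : HasDerivAt (fun p : ℝ => k - p) (-1) (P x) := (hasDerivAt_id _).const_sub k
    have hgv : grad v x = (-ω) • grad P x := by
      refine grad_comp (g := fun p => Real.log (k - p)) ?_ hPd
      simpa [ω, div_eq_mul_inv] using hd1.log hw0.ne'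
    have hgi : grad (fun y => (k - P y)⁻¹) x = (ω ^ 2) • grad P x := by
      refine grad_comp (g := fun p => (k - p)⁻¹) ?_ hPd
      have := hd1.inv hw0.ne'
      rw [neg_neg, one_div, ← inv_pow] at this
      exact this
    have hge : grad (fun y => η y ^ 2) x = (2 * η x) • grad η x :=
      grad_comp (g := fun t => t ^ 2) (by simpa using hasDerivAt_pow 2 (η x)) hηd
    have hgψ : grad ψ x = η x ^ 2 • (ω ^ 2 • grad P x) + ω • ((2 * η x) • grad η x) := by
      rw [← hgi, ← hge]
      exact grad_mul (P := fun y => η y ^ 2) (Q := fun y => (k - P y)⁻¹) (hηd.pow 2)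
        ((hwi.contDiffAt (hUo.mem_nhds hxU)).differentiableAt one_ne_zero)
    have h1 := hA.two_mul_bilin_le hx1 (η x • grad v x) (grad η x)
    have h2 : Λ⁻¹ * gradSq v x ≤ bilin (A x) (grad v x) (grad v x) := hA.lower x hx1 (grad v x)
    have h3 : bilin (A x) (grad η x) (grad η x) ≤ Λ * gradSq η x := hA.upper x hx1 (grad η x)
    have h4 : Λ * gradSq η x ≤ Λ * (16 / R ^ 2) :=
      mul_le_mul_of_nonneg_left (gradSq_cutoff_le hR hx) hΛ0.le
    have h5 := mul_le_mul_of_nonneg_left h2 (sq_nonneg (η x))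
    have h6 : Λ * (16 / R ^ 2) = 16 * Λ / R ^ 2 := by ring
    have h7 : 32 * Λ / R ^ 2 = 2 * (16 * Λ / R ^ 2) := by ring
    rw [hgψ, h7]
    rw [hgv] at h1 h5
    simp only [bilin_smul_left, bilin_smul_right, bilin_add_right] at h1 h5 ⊢
    linarith
  have hup : ∀ x ∈ K, L * ψ x ≤ 4 / R ^ 2 := fun x hx => by
    have h1 : ψ x ≤ 2 ^ 2 * δ⁻¹ := by
      refine mul_le_mul (pow_le_pow_left₀ (cutoff_nonneg c R x) (cutoff_le_two hR hx) 2) ?_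
        (inv_nonneg.2 (hw x (hKU hx)).le) (by norm_num)
      exact inv_anti₀ hδ0 (by linarith [hk x hx])
    calc L * ψ x ≤ L * (2 ^ 2 * δ⁻¹) := by gcongr
      _ = 4 / R ^ 2 := by rw [hδ]; field_simp; norm_num
  have hgc : ContinuousOn (fun x => η x ^ 2 * gradSq v x) K :=
    ((hηc.continuous.pow 2).continuousOn.mul (continuousOn_gradSq hUo hvc)).mono hKU
  have hgi : IntegrableOn (fun x => η x ^ 2 * gradSq v x) K := hgc.integrableOn_compact hKc
  have hvi : IntegrableOn (gradSq v) K :=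
    ((continuousOn_gradSq hUo hvc).mono hKU).integrableOn_compact hKc
  have hci : ∀ a : ℝ, IntegrableOn (fun _ => a) K := fun a =>
    continuousOn_const.integrableOn_compact hKc
  have hbi : IntegrableOn (fun x => bilin (A x) (grad P x) (grad ψ x)) K :=
    ((hA.continuousOn_bilin isOpen_ball subset_rfl hP.smooth hψc.contDiffOn).mono
      hs).integrableOn_compact hKc
  have h1 := setIntegral_mono_on ((hgi.const_mul (1 / 2 * Λ⁻¹)).sub (hci (32 * Λ / R ^ 2))) hbi
    hKcl.measurableSet hlow
  have h2 := setIntegral_mono_on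
    ((hψc.continuous.continuousOn.integrableOn_compact hKc).const_mul L)
    (hci (4 / R ^ 2)) hKcl.measurableSet hup
  simp only [Pi.sub_apply] at h1
  rw [integral_sub (hgi.const_mul _) (hci _), integral_const_mul,
    setIntegral_const_closedBall c hR.le] at h1
  rw [integral_const_mul, setIntegral_const_closedBall c hR.le] at h2
  have hBK : ball c (R / 2) ⊆ K := fun x hx => by
    have := mem_ball.1 hx
    exact mem_closedBall.2 (by linarith)
  have h3 : ∫ x in ball c (R / 2), 1 / 4 * gradSq v x ≤
      ∫ x in ball c (R / 2), η x ^ 2 * gradSq v x :=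
    setIntegral_mono_on ((hvi.mono_set hBK).const_mul _) (hgi.mono_set hBK) measurableSet_ball
      fun x hx => mul_le_mul_of_nonneg_right
        (by nlinarith [half_le_cutoff hR hx]) (gradSq_nonneg v x)
  have h4 : ∫ x in ball c (R / 2), η x ^ 2 * gradSq v x ≤ ∫ x in K, η x ^ 2 * gradSq v x :=
    setIntegral_mono_set hgi
      (Filter.Eventually.of_forall fun x => mul_nonneg (sq_nonneg _) (gradSq_nonneg v x))
      hBK.eventuallyLE
  rw [integral_const_mul] at h3
  set I := ∫ x in K, η x ^ 2 * gradSq v x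
  have h5 : 1 / 2 * Λ⁻¹ * I ≤
      Real.pi * R ^ 2 * (32 * Λ / R ^ 2) + Real.pi * R ^ 2 * (4 / R ^ 2) := by
    linarith
  have h6 : Real.pi * R ^ 2 * (32 * Λ / R ^ 2) + Real.pi * R ^ 2 * (4 / R ^ 2) =
      Real.pi * (32 * Λ + 4) := by field_simp
  have h7 : I ≤ 2 * Λ * (Real.pi * (32 * Λ + 4)) := by
    rw [h6] at h5
    calc I = 2 * Λ * (1 / 2 * Λ⁻¹ * I) := by field_simp
      _ ≤ _ := by gcongr
  have h8 : 2 * Λ * (Real.pi * (32 * Λ + 4)) ≤ 72 * Real.pi * Λ ^ 2 := by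
    nlinarith [mul_pos Real.pi_pos hΛ0]
  linarith

end

/-- Two circles whose radii are between half the distance of their centres and that distance
meet. -/
theorem exists_mem_sphere_inter {x y : E2} {ρ₁ ρ₂ : ℝ} (h₁ : ρ₁ ∈ Ioo (dist x y / 2) (dist x y))
    (h₂ : ρ₂ ∈ Ioo (dist x y / 2) (dist x y)) : ∃ z ∈ sphere x ρ₁, z ∈ sphere y ρ₂ := by
  set d := dist x y with hd
  have hd0 : 0 < d := by linarith [h₁.1, h₁.2]
  have hρ : 0 < ρ₁ := by linarith [h₁.1]
  have hconn : IsPreconnected (sphere x ρ₁) :=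
    (isConnected_sphere (by
      rw [← Module.finrank_eq_rank]
      simp) x hρ.le).isPreconnected
  have hp : ∀ t : ℝ, dist (AffineMap.lineMap x y t) y = |1 - t| * d := fun t => by
    rw [dist_lineMap_right, Real.norm_eq_abs]
  have hq : ∀ t : ℝ, dist (AffineMap.lineMap x y t) x = |t| * d := fun t => by
    rw [dist_lineMap_left, Real.norm_eq_abs]
  have ha : AffineMap.lineMap x y (ρ₁ / d) ∈ sphere x ρ₁ := by
    rw [mem_sphere, hq, abs_of_pos (div_pos hρ hd0), div_mul_cancel₀ _ hd0.ne']
  have hb : AffineMap.lineMap x y (-(ρ₁ / d)) ∈ sphere x ρ₁ := by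
    rw [mem_sphere, hq, abs_neg, abs_of_pos (div_pos hρ hd0), div_mul_cancel₀ _ hd0.ne']
  have hlt : ρ₁ / d < 1 := (div_lt_one hd0).2 h₁.2
  obtain ⟨z, hz, hz2⟩ := hconn.intermediate_value ha hb
    (f := fun z => dist z y) (by fun_prop) (show ρ₂ ∈ Icc _ _ by
      simp only [hp]
      rw [abs_of_pos (by linarith), abs_of_pos (by linarith [div_pos hρ hd0]), sub_neg_eq_add,
        sub_mul, add_mul, div_mul_cancel₀ _ hd0.ne', one_mul]
      exact ⟨by linarith [h₁.1, h₂.1], by linarith [h₂.2]⟩)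
  exact ⟨z, hz, hz2⟩

/-- A function with small energy is nearly constant on suitable circles around two given points. -/
theorem exists_two_circles {U : Set E2} (hU : IsOpen U) {v : E2 → ℝ} (hv : ContDiffOn ℝ 1 v U)
    {x y : E2} (hxy : x ≠ y) (hx : closedBall x (dist x y) ⊆ U) (hy : closedBall y (dist x y) ⊆ U)
    {K : ℝ} (hK : 0 ≤ K)
    (hxK : 4 * Real.pi * ∫ z in ball x (dist x y), gradSq v z ≤ K ^ 2)
    (hyK : 4 * Real.pi * ∫ z in ball y (dist x y), gradSq v z ≤ K ^ 2) :
    ∃ ρ₁ ∈ Ioo 0 (dist x y), ∃ ρ₂ ∈ Ioo 0 (dist x y), ∀ z ∈ sphere x ρ₁, ∀ z' ∈ sphere y ρ₂,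
      v z' ≤ v z + 2 * K := by
  have hd := dist_pos.2 hxy
  obtain ⟨ρ₁, hρ₁, h₁⟩ := exists_circle_osc_le hU hv hd hx
  obtain ⟨ρ₂, hρ₂, h₂⟩ := exists_circle_osc_le hU hv hd hy
  obtain ⟨p, hp₁, hp₂⟩ := exists_mem_sphere_inter hρ₁ hρ₂
  refine ⟨ρ₁, ⟨by linarith [hρ₁.1], hρ₁.2⟩, ρ₂, ⟨by linarith [hρ₂.1], hρ₂.2⟩,
    fun z hz z' hz' => ?_⟩
  have h3 := abs_le_of_sq_le_sq' ((h₁ p hp₁ z hz).trans hxK) hK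
  have h4 := abs_le_of_sq_le_sq' ((h₂ z' hz' p hp₂).trans hyK) hK
  linarith [h3.2, h4.2]

/-- If `P` and `P⁻¹` are both subsolutions then `k - P` satisfies a Harnack inequality. -/
theorem IsSub.harnack {Λ L : ℝ} {A : E2 → Matrix (Fin 2) (Fin 2) ℝ} {P Q : E2 → ℝ}
    (hP : IsSub A L P) (hQ : IsSub A L Q)
    (hA : IsElliptic Λ A) (hL : 0 < L) {S : ℝ} (hP0 : ∀ x ∈ ball (0 : E2) 1, 0 < P x)
    (hPS : ∀ x ∈ ball (0 : E2) 1, P x ≤ S) (hPQ : ∀ x ∈ ball (0 : E2) 1, Q x = (P x)⁻¹)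
    {c : E2} {R : ℝ} (hR : 0 < R) (hs : closedBall c R ⊆ ball 0 1) {k : ℝ}
    (hk : ∀ z ∈ closedBall c R, P z + L * R ^ 2 ≤ k) {x y : E2} (hx : x ∈ closedBall c (R / 8))
    (hy : y ∈ closedBall c (R / 8)) (hxy : x ≠ y) :
    k - P y ≤ Real.exp (220 * Λ) * (k - P x + 9 * Λ * L * R ^ 2) + 9 * Λ * L * R ^ 2 * S ^ 2 := by
  have hΛ := hA.one_le
  set d := dist x y with hd
  have hd0 : 0 < d := dist_pos.2 hxy
  have hdR : d ≤ R / 4 := by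
    have := dist_triangle_right x y c
    rw [mem_closedBall] at hx hy
    linarith
  have hδ : 0 < L * R ^ 2 := by positivity
  have hsub : ∀ p ∈ closedBall c (R / 8), closedBall p d ⊆ ball c (R / 2) := fun p hp z hz => by
    rw [mem_closedBall] at hp hz
    rw [mem_ball]
    linarith [dist_triangle z p c]
  have hbR : ball c (R / 2) ⊆ closedBall c R :=
    (ball_subset_ball (by linarith)).trans ball_subset_closedBall
  have hw : ∀ z ∈ ball c (R / 2), 0 < k - P z := fun z hz => by linarith [hk z (hbR hz)]
  set v : E2 → ℝ := fun z => Real.log (k - P z) with hvdef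
  have hvb : ContDiffOn ℝ 1 v (ball c R) :=
    contDiffOn_log_sub (hP.smooth.mono (ball_subset_closedBall.trans hs)) fun z hz => by
      linarith [hk z (ball_subset_closedBall hz)]
  have hbb : ball c (R / 2) ⊆ ball c R := ball_subset_ball (by linarith)
  have hcb : closedBall c (R / 2) ⊆ ball c R := closedBall_subset_ball (by linarith)
  have hE := hP.integral_gradSq_log_le hA hL hR hs hk
  have hvi : IntegrableOn (gradSq v) (ball c (R / 2)) :=
    (((continuousOn_gradSq isOpen_ball hvb).mono hcb).integrableOn_compact
      (isCompact_closedBall c _)).mono_set ball_subset_closedBall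
  have hEp : ∀ p ∈ closedBall c (R / 8),
      4 * Real.pi * ∫ z in ball p d, gradSq v z ≤ (110 * Λ) ^ 2 := fun p hp => by
    have h1 : ∫ z in ball p d, gradSq v z ≤ 288 * Real.pi * Λ ^ 2 :=
      (setIntegral_mono_set hvi (Filter.Eventually.of_forall fun z => gradSq_nonneg v z)
        (ball_subset_closedBall.trans (hsub p hp)).eventuallyLE).trans hE
    have h2 : Real.pi ^ 2 ≤ 10 := by nlinarith [Real.pi_lt_d2, Real.pi_pos]
    calc _ ≤ 4 * Real.pi * (288 * Real.pi * Λ ^ 2) := by gcongr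
      _ = 1152 * Λ ^ 2 * Real.pi ^ 2 := by ring
      _ ≤ 1152 * Λ ^ 2 * 10 := by gcongr
      _ ≤ _ := by nlinarith [sq_nonneg Λ]
  obtain ⟨ρ₁, hρ₁, ρ₂, hρ₂, hosc⟩ := exists_two_circles isOpen_ball hvb hxy
    ((hsub x hx).trans hbb) ((hsub y hy).trans hbb) (by positivity : 0 ≤ 110 * Λ) (hEp x hx)
    (hEp y hy)
  set H := Real.exp (220 * Λ) with hH
  have hH0 : 0 < H := Real.exp_pos _
  have hin : ∀ p ∈ closedBall c (R / 8), ∀ ρ ∈ Ioo 0 d, closedBall p ρ ⊆ ball c (R / 2) :=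
    fun p hp ρ hρ => (closedBall_subset_closedBall hρ.2.le).trans (hsub p hp)
  have hin₁ := hin x hx ρ₁ hρ₁
  have hin₂ := hin y hy ρ₂ hρ₂
  have hharn : ∀ z ∈ sphere x ρ₁, ∀ z' ∈ sphere y ρ₂, k - P z' ≤ H * (k - P z) :=
    fun z hz z' hz' => by
      have h1 := hw z (hin₁ (sphere_subset_closedBall hz))
      have h2 := hw z' (hin₂ (sphere_subset_closedBall hz'))
      have h3 := Real.exp_le_exp.2 (hosc z hz z' hz')
      simp only [v] at h3
      rw [Real.exp_add, Real.exp_log h1, Real.exp_log h2,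
        show 2 * (110 * Λ) = 220 * Λ by ring] at h3
      linarith
  set T := 9 * Λ * L * R ^ 2 with hT
  have hT0 : 0 < T := by positivity
  have hρT : ∀ ρ ∈ Ioo 0 d, 136 * Λ * L * ρ ^ 2 ≤ T := fun ρ hρ => by
    have h1 : ρ ^ 2 ≤ (R / 4) ^ 2 := pow_le_pow_left₀ hρ.1.le (hρ.2.le.trans hdR) 2
    have h2 : 136 * Λ * L * ρ ^ 2 ≤ 136 * Λ * L * (R / 4) ^ 2 := by gcongr
    have h3 : 0 < Λ * L * R ^ 2 := by positivity
    linarith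
  have hbU := hbR.trans hs
  have hA1 : ∀ z' ∈ sphere y ρ₂, k - P z' ≤ H * (k - P x + T) := fun z' hz' => by
    have h1 := hP.center_le hA hL hρ₁.1 (hin₁.trans hbU) (k := k - (k - P z') / H) fun z hz => by
      have := hharn z hz z' hz'
      rw [← div_le_iff₀' hH0] at this
      linarith
    have h2 := hρT ρ₁ hρ₁
    rw [← div_le_iff₀' hH0]
    linarith
  obtain ⟨z, hz, hmax⟩ := (isCompact_sphere y ρ₂).exists_isMaxOn
    ((NormedSpace.sphere_nonempty (x := y)).2 hρ₂.1.le) (f := Q)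
    (hQ.smooth.continuousOn.mono (sphere_subset_closedBall.trans (hin₂.trans hbU)))
  have h1 := hQ.center_le hA hL hρ₂.1 (hin₂.trans hbU) fun z' hz' => hmax hz'
  have hyU : y ∈ ball (0 : E2) 1 := hbU (hin₂ (mem_closedBall_self hρ₂.1.le))
  have hzU : z ∈ ball (0 : E2) 1 := hbU (hin₂ (sphere_subset_closedBall hz))
  rw [hPQ y hyU, hPQ z hzU] at h1
  have hPy := hP0 y hyU
  have hPz := hP0 z hzU
  have h2 : (P y)⁻¹ ≤ (P z)⁻¹ + T := by linarith [hρT ρ₂ hρ₂]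
  have h3 : P z - P y ≤ T * (P y * P z) := by
    have := mul_le_mul_of_nonneg_right h2 (mul_pos hPy hPz).le
    have e1 : (P y)⁻¹ * (P y * P z) = P z := by field_simp
    have e2 : ((P z)⁻¹ + T) * (P y * P z) = P y + T * (P y * P z) := by field_simp
    linarith
  have h4 : T * (P y * P z) ≤ T * S ^ 2 := by
    rw [sq]
    have := hPS y hyU
    have := hPS z hzU
    gcongr
    linarith
  linarith [hA1 z hz]

/-- The ratio bound of the exponential Harnack inequality. -/
def harnackConst (Λ : ℝ) : ℝ := Real.exp (220 * Λ) * Λ ^ 4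

theorem two_le_harnackConst {Λ : ℝ} (hΛ : 1 ≤ Λ) : 2 ≤ harnackConst Λ := by
  have h1 : 2 ≤ Real.exp (220 * Λ) := by linarith [Real.add_one_le_exp (220 * Λ)]
  have h2 : 1 ≤ Λ ^ 4 := one_le_pow₀ hΛ
  unfold harnackConst
  nlinarith

section
variable {Λ κ : ℝ} {A : E2 → Matrix (Fin 2) (Fin 2) ℝ} {b f F φ : E2 → ℝ}

theorem IsWeakSol.harnack (h : IsWeakSol Λ κ A b f F φ) (hΛ : 1 ≤ Λ) (hκ : 0 < κ) {c : E2} {R : ℝ}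
    (hR : 0 < R) (hs : closedBall c R ⊆ ball 0 1) {M : ℝ} (hM : ∀ z ∈ closedBall c R, φ z ≤ M)
    {x y : E2} (hx : x ∈ closedBall c (R / 8)) (hy : y ∈ closedBall c (R / 8)) (hxy : x ≠ y) :
    1 - Real.exp (-(Λ ^ 2 * (M - φ y))) ≤ Real.exp (220 * Λ) * (Λ ^ 2 * (M - φ x)) +
      57 * harnackConst Λ * Real.exp ((3 * Λ ^ 2 + 1) * κ) * R ^ 2 := by
  have hΛ0 : 0 < Λ := by linarith
  set s := Λ ^ 2 with hsdef
  have hs0 : 0 < s := by positivity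
  set L := 3 * Λ ^ 3 * Real.exp ((s + 1) * κ) with hL
  have hL0 : 0 < L := by positivity
  have hP : IsSub A L fun x => Real.exp (s * φ x) := h.isSub_exp hΛ hκ (abs_of_pos hs0)
  have hQ : IsSub A L fun x => Real.exp (-s * φ x) :=
    h.isSub_exp hΛ hκ (by rw [abs_neg, abs_of_pos hs0])
  set H := Real.exp (220 * Λ)
  set S := Real.exp (s * κ) with hS
  have hH1 : 1 ≤ H := Real.one_le_exp (by positivity)
  have hS1 : 1 ≤ S := Real.one_le_exp (by positivity)
  have key := hP.harnack hQ (h.isElliptic hΛ) hL0 (S := S) (fun x _ => Real.exp_pos _)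
    (fun x hx => Real.exp_le_exp.2 (mul_le_mul_of_nonneg_left (h.φ_le_κ x hx) hs0.le))
    (fun x _ => by rw [← Real.exp_neg, neg_mul]) hR hs (k := Real.exp (s * M) + L * R ^ 2)
    (fun z hz => by
      have := Real.exp_le_exp.2 (mul_le_mul_of_nonneg_left (hM z hz) hs0.le)
      linarith) hx hy hxy
  have hM0 : 0 ≤ M := (h.φ_nonneg c (hs (mem_closedBall_self hR.le))).trans
    (hM c (mem_closedBall_self hR.le))
  have hB : 57 * harnackConst Λ * Real.exp ((3 * s + 1) * κ) * R ^ 2 =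
      19 * Λ * H * S ^ 2 * (L * R ^ 2) := by
    have e1 : Real.exp ((3 * s + 1) * κ) = S ^ 2 * Real.exp ((s + 1) * κ) := by
      rw [hS, ← Real.exp_nat_mul, ← Real.exp_add]
      congr 1
      push_cast
      ring
    rw [e1, hL, harnackConst]
    ring
  rw [hB]
  have hδ : 0 < L * R ^ 2 := by positivity
  have hHS : 10 * Λ * H + 9 * Λ * S ^ 2 ≤ 19 * Λ * H * S ^ 2 := by
    have h1 : 1 ≤ S ^ 2 := one_le_pow₀ hS1
    have h2 : H ≤ H * S ^ 2 := le_mul_of_one_le_right (by linarith) h1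
    have h3 : S ^ 2 ≤ H * S ^ 2 := le_mul_of_one_le_left (by linarith) hH1
    nlinarith
  have h1 : Real.exp (s * M) - Real.exp (s * φ y) ≤
      H * (Real.exp (s * M) - Real.exp (s * φ x)) + 19 * Λ * H * S ^ 2 * (L * R ^ 2) := by
    have h2 := mul_le_mul_of_nonneg_right hHS hδ.le
    have h3 : H * (L * R ^ 2) ≤ Λ * H * (L * R ^ 2) := by
      have : H ≤ Λ * H := le_mul_of_one_le_left (by linarith) hΛ
      gcongr
    linarith
  set e := Real.exp (-(s * M)) with he
  have he0 : 0 < e := Real.exp_pos _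
  have he1 : e ≤ 1 := Real.exp_le_one_iff.2 (neg_nonpos.2 (by positivity))
  have h2 := mul_le_mul_of_nonneg_right h1 he0.le
  have e1 : Real.exp (s * M) * e = 1 := by rw [he, ← Real.exp_add]; simp
  have e2 : ∀ p, Real.exp (s * φ p) * e = Real.exp (-(s * (M - φ p))) := fun p => by
    rw [he, ← Real.exp_add]
    congr 1
    ring
  have h3 : 1 - Real.exp (-(s * (M - φ x))) ≤ s * (M - φ x) := by
    linarith [Real.add_one_le_exp (-(s * (M - φ x)))]
  have h4 : H * (1 - Real.exp (-(s * (M - φ x)))) ≤ H * (s * (M - φ x)) := by gcongr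
  have h5 : 19 * Λ * H * S ^ 2 * (L * R ^ 2) * e ≤ 19 * Λ * H * S ^ 2 * (L * R ^ 2) :=
    mul_le_of_le_one_right (by positivity) he1
  calc _ = (Real.exp (s * M) - Real.exp (s * φ y)) * e := by rw [sub_mul, e1, e2]
    _ ≤ _ := h2
    _ = H * (1 - Real.exp (-(s * (M - φ x)))) + 19 * Λ * H * S ^ 2 * (L * R ^ 2) * e := by
      rw [add_mul, mul_assoc H, sub_mul, e1, e2]
    _ ≤ _ := by linarith

theorem div_one_add_le_one_sub_exp_neg {t : ℝ} (ht : 0 ≤ t) :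
    t / (1 + t) ≤ 1 - Real.exp (-t) := by
  have h1 : Real.exp (-t) ≤ 1 / (1 + t) := by
    rw [Real.exp_neg, ← one_div]
    exact one_div_le_one_div_of_le (by linarith) (by linarith [Real.add_one_le_exp t])
  have h2 : t / (1 + t) = 1 - 1 / (1 + t) := by field_simp; ring
  linarith

/-- Decay of the oscillation. -/
theorem IsWeakSol.osc_decay (h : IsWeakSol Λ κ A b f F φ) (hΛ : 1 ≤ Λ) (hκ : 0 < κ) {c : E2}
    {R : ℝ} (hR : 0 < R) (hs : closedBall c R ⊆ ball 0 1) {ω : ℝ}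
    (hω : ∀ p ∈ closedBall c R, ∀ q ∈ closedBall c R, φ p - φ q ≤ ω) :
    ∀ p ∈ closedBall c (R / 8), ∀ q ∈ closedBall c (R / 8),
      φ p - φ q ≤ (1 - 1 / (harnackConst Λ * (1 + κ))) * ω +
        57 * harnackConst Λ * Real.exp ((3 * Λ ^ 2 + 1) * κ) * R ^ 2 := by
  intro x hx y hy
  have hH2 := two_le_harnackConst hΛ
  set B := 57 * harnackConst Λ * Real.exp ((3 * Λ ^ 2 + 1) * κ) * R ^ 2 with hB
  have hB0 : 0 ≤ B := by positivity
  have hτ1 : 1 / (harnackConst Λ * (1 + κ)) ≤ 1 := by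
    rw [div_le_one (by positivity)]
    nlinarith
  have hcR : closedBall c (R / 8) ⊆ closedBall c R := closedBall_subset_closedBall (by linarith)
  have hω0 : 0 ≤ ω := by simpa using hω c (mem_closedBall_self hR.le) c (mem_closedBall_self hR.le)
  by_cases hxy : x = y
  · rw [hxy, sub_self]
    have := mul_nonneg (sub_nonneg.2 hτ1) hω0
    linarith
  obtain ⟨z, hz, hmax⟩ := (isCompact_closedBall c R).exists_isMaxOn
    ⟨c, mem_closedBall_self hR.le⟩ (h.smooth_φ.continuousOn.mono hs)
  have key := h.harnack hΛ hκ hR hs (M := φ z) (fun p hp => hmax hp) hx hy hxy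
  rw [← hB] at key
  set t := φ z - φ y with ht
  set u := φ z - φ x with hu
  have ht0 : 0 ≤ t := sub_nonneg.2 (hmax (hcR hy))
  have hu0 : 0 ≤ u := sub_nonneg.2 (hmax (hcR hx))
  have htω : t ≤ ω := hω z hz y (hcR hy)
  have htκ : t ≤ κ := by
    have h1 := h.φ_le_κ z (hs hz)
    have h2 := h.φ_nonneg y (hs (hcR hy))
    linarith
  set H := Real.exp (220 * Λ) with hH
  have hH1 : 1 ≤ H := Real.one_le_exp (by linarith)
  have hs1 : 1 ≤ Λ ^ 2 := one_le_pow₀ hΛ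
  have h1 : t / (1 + κ) ≤ 1 - Real.exp (-(Λ ^ 2 * t)) := by
    have h2 := div_one_add_le_one_sub_exp_neg (by positivity : 0 ≤ Λ ^ 2 * t)
    refine le_trans ?_ h2
    rw [div_le_div_iff₀ (by positivity) (by positivity)]
    have h3 : t * (Λ ^ 2 * t) ≤ Λ ^ 2 * t * κ := by
      rw [mul_comm]
      gcongr
    nlinarith
  have hHs : harnackConst Λ = H * Λ ^ 2 * Λ ^ 2 := by rw [harnackConst]; ring
  have hm1 : 1 ≤ H * Λ ^ 2 := by nlinarith
  have h2 : t / (1 + κ) ≤ H * Λ ^ 2 * u + B := by linarith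
  have h3 : t / (harnackConst Λ * (1 + κ)) ≤ u + B := by
    have h4 : t / (harnackConst Λ * (1 + κ)) ≤ t / (1 + κ) / (H * Λ ^ 2) := by
      rw [div_div, mul_comm (1 + κ), hHs]
      gcongr
      exact le_mul_of_one_le_right (by positivity) hs1
    refine h4.trans ?_
    rw [div_le_iff₀ (by positivity)]
    nlinarith
  have h5 : φ x - φ y = t - u := by rw [ht, hu]; ring
  have h6 : (1 - 1 / (harnackConst Λ * (1 + κ))) * t ≤ (1 - 1 / (harnackConst Λ * (1 + κ))) * ω :=
    mul_le_mul_of_nonneg_left htω (sub_nonneg.2 hτ1)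
  have h7 : (1 - 1 / (harnackConst Λ * (1 + κ))) * t = t - t / (harnackConst Λ * (1 + κ)) := by ring
  linarith

theorem IsWeakSol.osc_iterate (h : IsWeakSol Λ κ A b f F φ) (hΛ : 1 ≤ Λ) (hκ : 0 < κ) {c : E2}
    {R : ℝ} (hR : 0 < R) (hs : closedBall c R ⊆ ball 0 1)
    (hRκ : Real.exp ((3 * Λ ^ 2 + 1) * κ) * R ^ 2 ≤ 1) (n : ℕ) :
    ∀ p ∈ closedBall c (R * (1 / 8) ^ n), ∀ q ∈ closedBall c (R * (1 / 8) ^ n),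
      φ p - φ q ≤ (1 - 1 / (harnackConst Λ * (1 + κ))) ^ n *
        (κ + 228 * harnackConst Λ * (1 - (1 / 2) ^ n)) := by
  have hH2 := two_le_harnackConst hΛ
  set D := harnackConst Λ
  set θ := 1 - 1 / (D * (1 + κ)) with hθ
  have hθ2 : 1 / 2 ≤ θ := by
    have : 1 / (D * (1 + κ)) ≤ 1 / 2 := one_div_le_one_div_of_le (by norm_num) (by nlinarith)
    linarith
  induction n with
  | zero =>
    intro p hp q hq
    rw [pow_zero, mul_one] at hp hq
    have h1 := h.φ_le_κ p (hs hp)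
    have h2 := h.φ_nonneg q (hs hq)
    simp only [pow_zero]
    linarith
  | succ n ih =>
    intro p hp q hq
    have hpow : (1 / 8 : ℝ) ^ n ≤ 1 := pow_le_one₀ (by norm_num) (by norm_num)
    have hle : R * (1 / 8) ^ n ≤ R := mul_le_of_le_one_right hR.le hpow
    have hr : R * (1 / 8) ^ (n + 1) = R * (1 / 8) ^ n / 8 := by rw [pow_succ]; ring
    rw [hr] at hp hq
    have h1 := h.osc_decay hΛ hκ (by positivity : 0 < R * (1 / 8) ^ n)
      ((closedBall_subset_closedBall hle).trans hs) ih p hp q hq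
    refine h1.trans ?_
    have h2 : 57 * D * Real.exp ((3 * Λ ^ 2 + 1) * κ) * (R * (1 / 8) ^ n) ^ 2 ≤
        57 * D * (1 / 64) ^ n := by
      have e : ((1 / 8 : ℝ) ^ n) ^ 2 = (1 / 64) ^ n := by
        rw [← pow_mul, mul_comm, pow_mul]
        norm_num
      rw [mul_pow, e]
      calc _ = 57 * D * (1 / 64) ^ n * (Real.exp ((3 * Λ ^ 2 + 1) * κ) * R ^ 2) := by ring
        _ ≤ 57 * D * (1 / 64) ^ n * 1 := by gcongr
        _ = _ := mul_one _
    have h3 : (1 / 64 : ℝ) ^ n ≤ (1 / 4) ^ n := pow_le_pow_left₀ (by norm_num) (by norm_num) n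
    have h4 : (1 / 2 : ℝ) ^ (n + 1) ≤ θ ^ (n + 1) := pow_le_pow_left₀ (by norm_num) hθ2 _
    have h5 : (1 / 4 : ℝ) ^ n = 4 * ((1 / 2) ^ (n + 1) * (1 / 2) ^ (n + 1)) := by
      rw [← mul_pow, pow_succ]
      norm_num
      ring
    have h6 : (1 / 2 : ℝ) ^ (n + 1) * (1 / 2) ^ (n + 1) ≤ θ ^ (n + 1) * (1 / 2) ^ (n + 1) := by
      gcongr
    have h7 : 57 * D * (1 / 64) ^ n ≤ 228 * D * (θ ^ (n + 1) * (1 / 2) ^ (n + 1)) := by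
      calc _ ≤ 57 * D * (4 * (θ ^ (n + 1) * (1 / 2) ^ (n + 1))) := by
            gcongr
            linarith
        _ = _ := by ring
    have h8 : (1 / 2 : ℝ) ^ n = 2 * (1 / 2) ^ (n + 1) := by rw [pow_succ]; ring
    calc _ ≤ θ ^ (n + 1) * (κ + 228 * D * (1 - (1 / 2) ^ n)) +
          228 * D * (θ ^ (n + 1) * (1 / 2) ^ (n + 1)) := by
          refine add_le_add (le_of_eq ?_) (h2.trans h7)
          rw [pow_succ']
          exact (mul_assoc _ _ _).symm
      _ = _ := by rw [h8]; ring

theorem IsWeakSol.abs_sub_le (h : IsWeakSol Λ κ A b f F φ) (hΛ : 1 ≤ Λ) (hκ : 0 < κ) {x y : E2}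
    (hx : x ∈ ball (0 : E2) 1) (hy : y ∈ ball (0 : E2) 1) {R : ℝ} (hR : 0 < R)
    (hs : closedBall x R ⊆ ball 0 1) (hRκ : Real.exp ((3 * Λ ^ 2 + 1) * κ) * R ^ 2 ≤ 1)
    {α : ℝ} (hα0 : 0 ≤ α) (hα : 3 * α ≤ 1 / (harnackConst Λ * (1 + κ))) (hxy : x ≠ y) :
    |φ x - φ y| ≤ (κ + 228 * harnackConst Λ) * (8 * ‖x - y‖ / R) ^ α := by
  have hH2 := two_le_harnackConst hΛ
  have hr : 0 < ‖x - y‖ := norm_pos_iff.2 (sub_ne_zero.2 hxy)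
  set D := harnackConst Λ
  rcases le_or_gt R ‖x - y‖ with hle | hlt
  · have h1 : |φ x - φ y| ≤ κ := abs_le.2
      ⟨by linarith [h.φ_nonneg x hx, h.φ_le_κ y hy], by linarith [h.φ_nonneg y hy, h.φ_le_κ x hx]⟩
    have h2 : 1 ≤ (8 * ‖x - y‖ / R) ^ α :=
      Real.one_le_rpow ((one_le_div hR).2 (by linarith)) hα0
    calc _ ≤ (κ + 228 * D) * 1 := by linarith
      _ ≤ _ := by gcongr
  · obtain ⟨n, hn1, hn2⟩ := exists_nat_pow_near_of_lt_one (div_pos hr hR)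
      ((div_le_one hR).2 hlt.le) (by norm_num : (0 : ℝ) < 1 / 8) (by norm_num)
    rw [div_le_iff₀' hR] at hn2
    have hit := h.osc_iterate hΛ hκ hR hs hRκ n
    have hxm : x ∈ closedBall x (R * (1 / 8) ^ n) := mem_closedBall_self (by positivity)
    have hym : y ∈ closedBall x (R * (1 / 8) ^ n) := by
      rwa [mem_closedBall, dist_comm, dist_eq_norm]
    set θ := 1 - 1 / (D * (1 + κ)) with hθ
    have hθ0 : 0 ≤ θ := by
      have : 1 / (D * (1 + κ)) ≤ 1 / 1 := one_div_le_one_div_of_le (by norm_num) (by nlinarith)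
      linarith
    have hθα : θ ≤ (1 / 8 : ℝ) ^ α := by
      rw [Real.rpow_def_of_pos (by norm_num)]
      have h8 : Real.log (1 / 8) = -(3 * Real.log 2) := by
        rw [one_div, Real.log_inv, show (8 : ℝ) = 2 ^ 3 by norm_num, Real.log_pow]
        norm_num
      have := Real.add_one_le_exp (Real.log (1 / 8) * α)
      rw [h8] at this ⊢
      nlinarith [Real.log_two_lt_d9]
    have hpow : θ ^ n ≤ (8 * ‖x - y‖ / R) ^ α := by
      calc θ ^ n ≤ ((1 / 8 : ℝ) ^ α) ^ n := pow_le_pow_left₀ hθ0 hθα n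
        _ = ((1 / 8 : ℝ) ^ n) ^ α := by
          rw [← Real.rpow_natCast, ← Real.rpow_mul (by norm_num), mul_comm, Real.rpow_mul
            (by norm_num), Real.rpow_natCast]
        _ ≤ _ := by
          refine Real.rpow_le_rpow (by positivity) ?_ hα0
          rw [pow_succ] at hn1
          rw [mul_div_assoc]
          linarith
    have hc : κ + 228 * D * (1 - (1 / 2) ^ n) ≤ κ + 228 * D := by
      have : (0 : ℝ) ≤ (1 / 2) ^ n := by positivity
      nlinarith
    have hfin : θ ^ n * (κ + 228 * D * (1 - (1 / 2) ^ n)) ≤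
        (κ + 228 * D) * (8 * ‖x - y‖ / R) ^ α := by
      rw [mul_comm (κ + 228 * D)]
      calc _ ≤ θ ^ n * (κ + 228 * D) := by gcongr
        _ ≤ _ := by gcongr
    exact abs_le.2 ⟨by linarith [hit y hym x hxm], by linarith [hit x hxm y hym]⟩

end

/-- De Giorgi–Nash–Moser interior Hölder estimate with explicit dependence on `κ`:
for every `Λ ≥ 1` there are `C > 0` and `ε₀ ∈ (0,1)` depending only on `Λ` such that for every
`κ > 0` and every `κ`-bounded weak solution with ellipticity `Λ` on `B₁`, setting
`α = ε₀ e^{-4Λκ}`, one has `|φ(x) - φ(y)| ≤ C e^{κ} |x - y|^α` for all `x, y ∈ B_{1/2}`. -/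
theorem stmt8 (Λ : ℝ) (hΛ : 1 ≤ Λ) :
    ∃ C > (0 : ℝ), ∃ ε₀ ∈ Ioo (0 : ℝ) 1,
      ∀ κ > (0 : ℝ),
        ∀ (A : E2 → Matrix (Fin 2) (Fin 2) ℝ) (b f F φ : E2 → ℝ),
          IsWeakSol Λ κ A b f F φ →
            ∀ x ∈ ball (0 : E2) (1 / 2), ∀ y ∈ ball (0 : E2) (1 / 2),
              |φ x - φ y| ≤ C * Real.exp κ * ‖x - y‖ ^ (ε₀ * Real.exp (-(4 * Λ * κ))) := by
  have hH2 := two_le_harnackConst hΛ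
  set D := harnackConst Λ
  set E := 3 * Λ ^ 2 + 1 with hE
  refine ⟨32 * Real.exp (E / 2) * (1 + 228 * D), by positivity, 1 / (3 * D),
    ⟨by positivity, ?_⟩, ?_⟩
  · rw [div_lt_one (by positivity)]
    linarith
  intro κ hκ A b f F φ h x hx y hy
  by_cases hxy : x = y
  · rw [hxy, sub_self, abs_zero]
    positivity
  set α := 1 / (3 * D) * Real.exp (-(4 * Λ * κ)) with hαdef
  have hα0 : 0 < α := by positivity
  have hexp : Real.exp (-(4 * Λ * κ)) ≤ 1 / (1 + κ) := by
    rw [Real.exp_neg, ← one_div]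
    refine one_div_le_one_div_of_le (by linarith) ?_
    nlinarith [Real.add_one_le_exp (4 * Λ * κ)]
  have hα : 3 * α ≤ 1 / (D * (1 + κ)) := by
    calc 3 * α = 1 / D * Real.exp (-(4 * Λ * κ)) := by rw [hαdef]; field_simp
      _ ≤ 1 / D * (1 / (1 + κ)) := by gcongr
      _ = _ := by field_simp
  have hακ : α * (1 + κ) ≤ 1 := by
    rw [le_div_iff₀ (by positivity)] at hα
    have : 0 < α * (1 + κ) := by positivity
    nlinarith
  have hbb : ball (0 : E2) (1 / 2) ⊆ ball 0 1 := ball_subset_ball (by norm_num)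
  set R := 1 / 4 * Real.exp (-(E * κ / 2)) with hR
  have hR0 : 0 < R := by positivity
  have hR4 : R ≤ 1 / 4 :=
    mul_le_of_le_one_right (by norm_num) (Real.exp_le_one_iff.2 (neg_nonpos.2 (by positivity)))
  have hs : closedBall x R ⊆ ball 0 1 := fun z hz => by
    rw [mem_closedBall] at hz
    rw [mem_ball] at hx ⊢
    linarith [dist_triangle z x 0]
  have hRκ : Real.exp (E * κ) * R ^ 2 ≤ 1 := by
    have e : Real.exp (-(E * κ / 2)) ^ 2 = (Real.exp (E * κ))⁻¹ := by
      rw [← Real.exp_nat_mul, ← Real.exp_neg]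
      congr 1
      push_cast
      ring
    rw [hR, mul_pow, e, mul_left_comm, mul_inv_cancel₀ (Real.exp_pos _).ne']
    norm_num
  have key := h.abs_sub_le hΛ hκ (hbb hx) (hbb hy) hR0 hs hRκ hα0.le hα hxy
  have hfac : (8 * ‖x - y‖ / R) ^ α ≤ 32 * Real.exp (E / 2) * ‖x - y‖ ^ α := by
    have e : 8 * ‖x - y‖ / R = 32 * Real.exp (E * κ / 2) * ‖x - y‖ := by
      rw [hR, Real.exp_neg]
      field_simp
      ring
    rw [e, Real.mul_rpow (by positivity) (norm_nonneg _), Real.mul_rpow (by norm_num)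
      (Real.exp_pos _).le, ← Real.exp_mul]
    have h1 : (32 : ℝ) ^ α ≤ 32 := by
      have : α ≤ 1 := by nlinarith
      simpa using Real.rpow_le_rpow_of_exponent_le (by norm_num : (1 : ℝ) ≤ 32) this
    have h2 : Real.exp (E * κ / 2 * α) ≤ Real.exp (E / 2) := by
      apply Real.exp_le_exp.2
      have h3 : α * κ ≤ 1 := by linarith
      have h4 : 0 < E := by positivity
      nlinarith
    gcongr
  have hκe : κ ≤ Real.exp κ := by linarith [Real.add_one_le_exp κ]
  have h1e : 1 ≤ Real.exp κ := Real.one_le_exp hκ.le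
  have hcoef : κ + 228 * D ≤ (1 + 228 * D) * Real.exp κ := by nlinarith
  calc _ ≤ _ := key
    _ ≤ (1 + 228 * D) * Real.exp κ * (32 * Real.exp (E / 2) * ‖x - y‖ ^ α) := by gcongr
    _ = _ := by ring
end
end
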